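/- Let 0 < c1 ≤ c2 be constants and let n range over an increasing sequence of integers along which c1 ≤ f(k0(n)) ≤ c2. Then for G = G(n,1/2): (1) the probability that one of the following four events holds tends to 1 as n → ∞: (a) α(G)=k0 and β(G)=k0+2; (b) α(G)=k0 and β(G)=k0+1; (c) α(G)=k0−1 and β(G)=k0+2; (d) α(G)=k0−1 and β(G)=k0+1; and (2) for each of the four events, its probability is bounded away from 0 and from 1 along the sequence (its liminf is positive and its limsup is less than 1). -/

import Mathlib

open MeasureTheory ProbabilityTheory Filter Real

namespace RandomBipartiteDecomposition

/-- The set of edges of the complete bipartite graph with vertex classes `A` and `B`. -/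
def bicliqueEdges {V : Type*} (A B : Finset V) : Set (Sym2 V) :=
  {e | ∃ a ∈ A, ∃ b ∈ B, e = s(a, b)}

/-- `A`, `B` are the vertex classes of a complete bipartite subgraph of `G`. -/
def IsBicliqueIn {V : Type*} (G : SimpleGraph V) (A B : Finset V) : Prop :=
  A.Nonempty ∧ B.Nonempty ∧ Disjoint A B ∧ ∀ a ∈ A, ∀ b ∈ B, G.Adj a b

/-- A complete bipartite subgraph is nontrivial if both classes have at least 2 vertices. -/
def IsNontrivialBicliqueIn {V : Type*} (G : SimpleGraph V) (A B : Finset V) : Prop :=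
  2 ≤ A.card ∧ 2 ≤ B.card ∧ Disjoint A B ∧ ∀ a ∈ A, ∀ b ∈ B, G.Adj a b

/-- `P` lists `m` pairwise edge-disjoint complete bipartite subgraphs of `G` such that
every edge of `G` belongs to exactly one of them. -/
def IsBicliqueDecomp {V : Type*} (G : SimpleGraph V) (m : ℕ)
    (P : Fin m → Finset V × Finset V) : Prop :=
  (∀ i, IsBicliqueIn G (P i).1 (P i).2) ∧
  (∀ i j, i ≠ j →
    Disjoint (bicliqueEdges (P i).1 (P i).2) (bicliqueEdges (P j).1 (P j).2)) ∧
  (⋃ i, bicliqueEdges (P i).1 (P i).2) = G.edgeSet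

/-- As above but with all complete bipartite subgraphs nontrivial. -/
def IsNontrivialBicliqueDecomp {V : Type*} (G : SimpleGraph V) (m : ℕ)
    (P : Fin m → Finset V × Finset V) : Prop :=
  (∀ i, IsNontrivialBicliqueIn G (P i).1 (P i).2) ∧
  (∀ i j, i ≠ j →
    Disjoint (bicliqueEdges (P i).1 (P i).2) (bicliqueEdges (P j).1 (P j).2)) ∧
  (⋃ i, bicliqueEdges (P i).1 (P i).2) = G.edgeSet

/-- `τ(G)`: the minimum number of pairwise edge-disjoint complete bipartite subgraphs
of `G` so that each edge of `G` belongs to exactly one of them. -/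
noncomputable def tau {V : Type*} (G : SimpleGraph V) : ℕ :=
  sInf {m | ∃ P : Fin m → Finset V × Finset V, IsBicliqueDecomp G m P}

/-- `τ'(G)`: the minimum number of pairwise edge-disjoint *nontrivial* complete bipartite
subgraphs of `G` covering all edges of `G`; `⊤` if there is no such cover. -/
noncomputable def tau' {V : Type*} (G : SimpleGraph V) : ℕ∞ :=
  sInf {t : ℕ∞ | ∃ m : ℕ, t = m ∧ ∃ P : Fin m → Finset V × Finset V,
    IsNontrivialBicliqueDecomp G m P}

/-- `S` is an independent set of `G`. -/
def IsIndepFinset {V : Type*} (G : SimpleGraph V) (S : Finset V) : Prop :=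
  ∀ a ∈ S, ∀ b ∈ S, ¬ G.Adj a b

/-- `α(G)`: the maximum size of an independent set of `G`. -/
noncomputable def alpha {V : Type*} (G : SimpleGraph V) : ℕ :=
  sSup {k | ∃ S : Finset V, S.card = k ∧ IsIndepFinset G S}

/-- `S` induces in `G` a complete bipartite graph with nonempty vertex classes `A`, `B`. -/
def IsInducedCompleteBipartite {V : Type*} (G : SimpleGraph V) (S A B : Finset V) : Prop :=
  A.Nonempty ∧ B.Nonempty ∧ Disjoint A B ∧ (A : Set V) ∪ (B : Set V) = (S : Set V) ∧
  ∀ u ∈ S, ∀ v ∈ S, (G.Adj u v ↔ ((u ∈ A ∧ v ∈ B) ∨ (u ∈ B ∧ v ∈ A)))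

/-- `β(G)`: the largest number of vertices of an induced complete bipartite subgraph. -/
noncomputable def beta {V : Type*} (G : SimpleGraph V) : ℕ :=
  sSup {k | ∃ S A B : Finset V, IsInducedCompleteBipartite G S A B ∧ S.card = k}

/-- The Bernoulli measure on `Bool` giving `true` probability `p`. -/
noncomputable def bernoulliBool (p : ℝ) : Measure Bool :=
  p.toNNReal • Measure.dirac true + (1 - p).toNNReal • Measure.dirac false

instance (p : ℝ) : IsFiniteMeasure (bernoulliBool p) := by
  unfold bernoulliBool; infer_instance

/-- The Erdős–Rényi random graph `G(n,p)`: each unordered pair of vertices flips an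
independent `p`-coin. Events about the graph are subsets of the coin-flip space. -/
noncomputable def erdosRenyi (n : ℕ) (p : ℝ) : Measure (Sym2 (Fin n) → Bool) :=
  Measure.pi fun _ => bernoulliBool p

/-- The simple graph determined by the coin flips `ω`. -/
def graphOf (n : ℕ) (ω : Sym2 (Fin n) → Bool) : SimpleGraph (Fin n) :=
  SimpleGraph.fromEdgeSet {e | ω e = true}

/-- `f(k) = C(n,k) · 2^{-C(k,2)}`, the expected number of independent sets of size `k`
in `G(n,1/2)`. -/
noncomputable def f (n k : ℕ) : ℝ :=
  (n.choose k : ℝ) * (2 : ℝ) ^ (-(k.choose 2 : ℤ))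

/-- `k₀(n)`: the largest `k` with `f(k) ≥ 1`. -/
noncomputable def k0 (n : ℕ) : ℕ := sSup {k | 1 ≤ f n k}

/-- `g(k) = C(n,k+2) · (2^{k+1} - 1) · 2^{-C(k+2,2)}`, the expected number of induced
complete bipartite subgraphs on `k+2` vertices in `G(n,1/2)`. -/
noncomputable def g (n k : ℕ) : ℝ :=
  (n.choose (k + 2) : ℝ) * ((2 : ℝ) ^ (k + 1) - 1) * (2 : ℝ) ^ (-((k + 2).choose 2 : ℤ))

/-- The number of independent sets of size `k` in the graph determined by `ω`. -/
noncomputable def numIndep (n k : ℕ) (ω : Sym2 (Fin n) → Bool) : ℕ :=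
  Set.ncard {S : Finset (Fin n) | S.card = k ∧ IsIndepFinset (graphOf n ω) S}

/-- The number of `m`-element vertex subsets inducing a complete bipartite graph in the
graph determined by `ω`. -/
noncomputable def numBip (n m : ℕ) (ω : Sym2 (Fin n) → Bool) : ℕ :=
  Set.ncard {S : Finset (Fin n) | S.card = m ∧
    ∃ A B : Finset (Fin n), IsInducedCompleteBipartite (graphOf n ω) S A B}

/-! ### Fair coins -/

instance : IsProbabilityMeasure (bernoulliBool (1 / 2)) := by
  constructor
  simp only [bernoulliBool, Measure.add_apply, Measure.smul_apply, measure_univ]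
  rw [← add_smul, ← Real.toNNReal_add (by norm_num) (by norm_num)]
  norm_num

instance (n : ℕ) : IsProbabilityMeasure (erdosRenyi n (1 / 2)) := by
  unfold erdosRenyi; infer_instance

theorem bernoulliBool_not :
    MeasurePreserving not (bernoulliBool (1 / 2)) (bernoulliBool (1 / 2)) := by
  refine ⟨measurable_of_finite _, ?_⟩
  rw [bernoulliBool, Measure.map_add _ _ (measurable_of_finite _)]
  simp only [Measure.map_smul, Measure.map_dirac]
  rw [add_comm]
  norm_num

/-- Membership in `F` depends only on the coins in `E`. -/
def DeterminedBy {ι : Type*} (F : Set (ι → Bool)) (E : Set ι) : Prop :=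
  ∀ ω ω' : ι → Bool, (∀ e ∈ E, ω e = ω' e) → ω ∈ F → ω' ∈ F

theorem DeterminedBy.mono {ι : Type*} {F : Set (ι → Bool)} {E E' : Set ι}
    (h : DeterminedBy F E) (hE : E ⊆ E') : DeterminedBy F E' :=
  fun ω ω' hω => h ω ω' fun e he => hω e (hE he)

theorem DeterminedBy.inter {ι : Type*} {F F' : Set (ι → Bool)} {E : Set ι}
    (h : DeterminedBy F E) (h' : DeterminedBy F' E) : DeterminedBy (F ∩ F') E :=
  fun ω ω' hω hF => ⟨h ω ω' hω hF.1, h' ω ω' hω hF.2⟩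

theorem determinedBy_univ {ι : Type*} (E : Set ι) :
    DeterminedBy (Set.univ : Set (ι → Bool)) E := fun _ _ _ _ => trivial

theorem determinedBy_coin {ι : Type*} (e : ι) (b : Bool) {E : Set ι} (he : e ∈ E) :
    DeterminedBy {ω : ι → Bool | ω e = b} E := by
  intro ω ω' h hω
  simpa [← h e he] using hω

/-- The coins in `E` show the pattern `c`. -/
def patternSet {ι : Type*} (E : Finset ι) (c : ι → Bool) : Set (ι → Bool) :=
  {ω | ∀ e ∈ E, ω e = c e}

theorem determinedBy_patternSet {ι : Type*} (E : Finset ι) (c : ι → Bool) {E' : Set ι}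
    (hE : (E : Set ι) ⊆ E') : DeterminedBy (patternSet E c) E' := by
  intro ω ω' h hω e he
  rw [← h e (hE he)]
  exact hω e he

section Coins

variable {n : ℕ}

theorem measurableSet_coins (F : Set (Sym2 (Fin n) → Bool)) : MeasurableSet F :=
  F.toFinite.measurableSet

theorem real_inter_coin (e : Sym2 (Fin n)) (b : Bool) {F : Set (Sym2 (Fin n) → Bool)}
    (hF : DeterminedBy F {e}ᶜ) :
    (erdosRenyi n (1 / 2)).real ({ω | ω e = b} ∩ F) = (erdosRenyi n (1 / 2)).real F / 2 := by
  classical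
  have hmp : MeasurePreserving
      (fun (ω : Sym2 (Fin n) → Bool) i => (if i = e then not else id) (ω i))
      (erdosRenyi n (1 / 2)) (erdosRenyi n (1 / 2)) := by
    refine measurePreserving_pi _ _ fun i => ?_
    split_ifs
    · exact bernoulliBool_not
    · exact MeasurePreserving.id _
  have hflip : ∀ b, (erdosRenyi n (1 / 2)).real ({ω | ω e = b} ∩ F)
      = (erdosRenyi n (1 / 2)).real ({ω | ω e = !b} ∩ F) := by
    intro b
    rw [← hmp.measureReal_preimage (measurableSet_coins _).nullMeasurableSet]
    congr 1
    ext ω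
    simp only [Set.mem_preimage, Set.mem_inter_iff, Set.mem_ofPred_eq, if_true]
    refine and_congr (by cases ω e <;> cases b <;> simp) ⟨fun h => ?_, fun h => ?_⟩
    · exact hF _ _ (fun i hi => by simp [show i ≠ e from hi]) h
    · exact hF _ _ (fun i hi => by simp [show i ≠ e from hi]) h
  have hadd : (erdosRenyi n (1 / 2)).real F
      = (erdosRenyi n (1 / 2)).real ({ω | ω e = b} ∩ F)
        + (erdosRenyi n (1 / 2)).real ({ω | ω e = !b} ∩ F) := by
    rw [← measureReal_union _ (measurableSet_coins _)]
    · congr 1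
      ext ω
      cases h : ω e <;> cases b <;> simp [h]
    · rw [Set.disjoint_left]
      rintro ω ⟨h, -⟩ ⟨h', -⟩
      simp only [Set.mem_ofPred_eq] at h h'
      rw [h] at h'
      cases b <;> simp at h'
  rw [hadd, ← hflip b]
  ring

theorem real_patternSet_inter (E : Finset (Sym2 (Fin n))) (c : Sym2 (Fin n) → Bool)
    {F : Set (Sym2 (Fin n) → Bool)} (hF : DeterminedBy F (E : Set (Sym2 (Fin n)))ᶜ) :
    (erdosRenyi n (1 / 2)).real (patternSet E c ∩ F)
      = (1 / 2) ^ E.card * (erdosRenyi n (1 / 2)).real F := by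
  classical
  induction E using Finset.induction_on with
  | empty => simp [patternSet]
  | insert e E he ih =>
    have h1 : patternSet (insert e E) c ∩ F = {ω | ω e = c e} ∩ (patternSet E c ∩ F) := by
      ext ω
      simp [patternSet, and_assoc]
    rw [h1, real_inter_coin, ih (hF.mono ?_), Finset.card_insert_of_notMem he]
    · ring
    · exact Set.compl_subset_compl.2 (by simp)
    · refine DeterminedBy.inter (determinedBy_patternSet _ _ ?_) (hF.mono ?_)
      · intro x hx hxe
        rw [Set.mem_singleton_iff] at hxe
        exact he (hxe ▸ hx)
      · exact Set.compl_subset_compl.2 (by simp)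

theorem real_patternSet (E : Finset (Sym2 (Fin n))) (c : Sym2 (Fin n) → Bool) :
    (erdosRenyi n (1 / 2)).real (patternSet E c) = (1 / 2) ^ E.card := by
  have h := real_patternSet_inter E c (determinedBy_univ (E : Set (Sym2 (Fin n)))ᶜ)
  rwa [Set.inter_univ, probReal_univ, mul_one] at h

/-- Events determined by disjoint sets of coins are independent. -/
theorem real_inter_eq_mul (E : Finset (Sym2 (Fin n))) {D F : Set (Sym2 (Fin n) → Bool)}
    (hD : DeterminedBy D E) (hF : DeterminedBy F (E : Set (Sym2 (Fin n)))ᶜ) :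
    (erdosRenyi n (1 / 2)).real (D ∩ F)
      = (erdosRenyi n (1 / 2)).real D * (erdosRenyi n (1 / 2)).real F := by
  classical
  induction E using Finset.induction_on generalizing D F with
  | empty =>
    by_cases h : ∃ ω, ω ∈ D
    · obtain ⟨ω, hω⟩ := h
      have : D = Set.univ := Set.eq_univ_of_forall fun ω' => hD ω ω' (by simp) hω
      rw [this, Set.univ_inter, probReal_univ, one_mul]
    · have : D = ∅ := Set.eq_empty_of_forall_notMem fun ω hω => h ⟨ω, hω⟩
      simp [this]
  | insert e E he ih =>
    have hsplit : ∀ S : Set (Sym2 (Fin n) → Bool), (erdosRenyi n (1 / 2)).real S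
        = (erdosRenyi n (1 / 2)).real (S ∩ {ω | ω e = true})
          + (erdosRenyi n (1 / 2)).real (S ∩ {ω | ω e = false}) := by
      intro S
      rw [← measureReal_union _ (measurableSet_coins _)]
      · congr 1
        ext ω
        cases h : ω e <;> simp [h]
      · rw [Set.disjoint_left]
        rintro ω ⟨-, h⟩ ⟨-, h'⟩
        simp_all
    have key : ∀ (b : Bool) (G : Set (Sym2 (Fin n) → Bool)),
        DeterminedBy G ((insert e E : Finset _) : Set (Sym2 (Fin n)))ᶜ →
        (erdosRenyi n (1 / 2)).real (D ∩ G ∩ {ω | ω e = b})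
          = (erdosRenyi n (1 / 2)).real {ω | Function.update ω e b ∈ D}
            * ((erdosRenyi n (1 / 2)).real G / 2) := by
      intro b G hG
      have h1 : D ∩ G ∩ {ω | ω e = b}
          = {ω | Function.update ω e b ∈ D} ∩ ({ω | ω e = b} ∩ G) := by
        ext ω
        simp only [Set.mem_inter_iff, Set.mem_ofPred_eq]
        constructor
        · rintro ⟨⟨h1, h2⟩, rfl⟩
          simpa using ⟨h1, h2⟩
        · rintro ⟨h1, rfl, h2⟩
          simp at h1
          exact ⟨⟨h1, h2⟩, rfl⟩
      rw [h1, ih, real_inter_coin e b (hG.mono (Set.compl_subset_compl.2 (by simp)))]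
      · intro ω ω' h hω
        refine hD _ _ (fun i hi => ?_) hω
        by_cases hie : i = e
        · subst hie; simp
        · simp only [Function.update_of_ne hie]
          exact h i (by simpa [hie] using hi)
      · exact (determinedBy_coin e b (by simpa using he)).inter
          (hG.mono (Set.compl_subset_compl.2 (by simp)))
    have hDs : (erdosRenyi n (1 / 2)).real D
        = (erdosRenyi n (1 / 2)).real {ω | Function.update ω e true ∈ D} / 2
          + (erdosRenyi n (1 / 2)).real {ω | Function.update ω e false ∈ D} / 2 := by
      have h1 := key true Set.univ (determinedBy_univ _)
      have h2 := key false Set.univ (determinedBy_univ _)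
      simp only [Set.inter_univ, probReal_univ] at h1 h2
      rw [hsplit D, h1, h2]
      ring
    rw [hsplit (D ∩ F), key true F hF, key false F hF, hDs]
    ring

end Coins

/-! ### Poisson approximation and Chebyshev for families of local events -/

section LocalEvents

variable {n : ℕ} {τ : Type*}

/-- None of the events `D T`, `T ∈ 𝓕`, occurs. -/
def noneOf (D : τ → Set (Sym2 (Fin n) → Bool)) (𝓕 : Finset τ) :
    Set (Sym2 (Fin n) → Bool) := {ω | ∀ T ∈ 𝓕, ω ∉ D T}

theorem determinedBy_noneOf {D : τ → Set (Sym2 (Fin n) → Bool)} {𝓕 : Finset τ}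
    {E : Set (Sym2 (Fin n))} (h : ∀ T ∈ 𝓕, DeterminedBy (D T) E) :
    DeterminedBy (noneOf D 𝓕) E := by
  intro ω ω' hω hn T hT hT'
  exact hn T hT (h T hT ω' ω (fun e he => (hω e he).symm) hT')

theorem real_inter_noneOf_filter_le (D : τ → Set (Sym2 (Fin n) → Bool)) (𝓕 : Finset τ)
    (p : τ → Prop) [DecidablePred p] (A : Set (Sym2 (Fin n) → Bool)) :
    (erdosRenyi n (1 / 2)).real (A ∩ noneOf D (𝓕.filter fun T => ¬ p T))
      ≤ (erdosRenyi n (1 / 2)).real (A ∩ noneOf D 𝓕)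
        + ∑ T ∈ 𝓕 with p T, (erdosRenyi n (1 / 2)).real (A ∩ D T) := by
  have hsub : A ∩ noneOf D (𝓕.filter fun T => ¬ p T)
      ⊆ (A ∩ noneOf D 𝓕) ∪ ⋃ T ∈ 𝓕.filter p, (A ∩ D T) := by
    rintro ω ⟨hA, hω⟩
    by_cases h : ω ∈ noneOf D 𝓕
    · exact Or.inl ⟨hA, h⟩
    · right
      simp only [noneOf, Set.mem_ofPred_eq, not_forall, not_not] at h
      obtain ⟨T, hT, hD⟩ := h
      have hp : p T := by
        by_contra hp
        exact hω T (Finset.mem_filter.2 ⟨hT, hp⟩) hD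
      exact Set.mem_biUnion (Finset.mem_coe.2 (Finset.mem_filter.2 ⟨hT, hp⟩)) ⟨hA, hD⟩
  calc _ ≤ _ := measureReal_mono hsub
    _ ≤ _ := measureReal_union_le _ _
    _ ≤ _ := by gcongr; exact measureReal_biUnion_finset_le _ _

theorem sq_sum_mul_real_noneOf_le (D : τ → Set (Sym2 (Fin n) → Bool))
    (E : τ → Finset (Sym2 (Fin n))) (𝓕 : Finset τ)
    (hD : ∀ T ∈ 𝓕, DeterminedBy (D T) (E T : Set (Sym2 (Fin n)))) :
    (∑ T ∈ 𝓕, (erdosRenyi n (1 / 2)).real (D T)) ^ 2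
        * (erdosRenyi n (1 / 2)).real (noneOf D 𝓕)
      ≤ ∑ T ∈ 𝓕, ∑ T' ∈ 𝓕 with ¬ Disjoint (E T) (E T'),
        (erdosRenyi n (1 / 2)).real (D T ∩ D T') := by
  set μ := erdosRenyi n (1 / 2) with hμ
  set I : τ → (Sym2 (Fin n) → Bool) → ℝ := fun T => (D T).indicator 1 with hI
  have hint : ∀ h : (Sym2 (Fin n) → Bool) → ℝ, Integrable h μ := fun h => Integrable.of_finite
  have hcov : ∀ T T', ∫ ω, (I T ω - μ.real (D T)) * (I T' ω - μ.real (D T')) ∂μ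
      = μ.real (D T ∩ D T') - μ.real (D T) * μ.real (D T') := by
    intro T T'
    have hI1 : ∀ S : Set (Sym2 (Fin n) → Bool),
        ∫ ω, S.indicator (1 : (Sym2 (Fin n) → Bool) → ℝ) ω ∂μ = μ.real S :=
      fun S => integral_indicator_one (measurableSet_coins S)
    have hpt : ∀ ω, (I T ω - μ.real (D T)) * (I T' ω - μ.real (D T'))
        = (D T ∩ D T').indicator (1 : (Sym2 (Fin n) → Bool) → ℝ) ω
          - μ.real (D T') * I T ω
          - μ.real (D T) * I T' ω + μ.real (D T) * μ.real (D T') := by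
      intro ω
      rw [Set.inter_indicator_one]
      simp only [hI, Pi.mul_apply]
      ring
    simp only [hpt]
    rw [integral_add (hint _) (hint _), integral_sub (hint _) (hint _),
      integral_sub (hint _) (hint _), integral_const_mul, integral_const_mul, hI1, hI1, hI1]
    simp
    ring
  have hvar : ∫ ω, (∑ T ∈ 𝓕, (I T ω - μ.real (D T))) ^ 2 ∂μ
      = ∑ T ∈ 𝓕, ∑ T' ∈ 𝓕, (μ.real (D T ∩ D T') - μ.real (D T) * μ.real (D T')) := by
    simp only [sq, Finset.sum_mul_sum]
    rw [integral_finsetSum _ fun _ _ => hint _]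
    refine Finset.sum_congr rfl fun T _ => ?_
    rw [integral_finsetSum _ fun _ _ => hint _]
    exact Finset.sum_congr rfl fun T' _ => hcov T T'
  calc (∑ T ∈ 𝓕, μ.real (D T)) ^ 2 * μ.real (noneOf D 𝓕)
      = ∫ ω, (noneOf D 𝓕).indicator (fun _ => (∑ T ∈ 𝓕, μ.real (D T)) ^ 2) ω ∂μ := by
        rw [integral_indicator_const _ (measurableSet_coins _), smul_eq_mul, mul_comm]
    _ ≤ ∫ ω, (∑ T ∈ 𝓕, (I T ω - μ.real (D T))) ^ 2 ∂μ := by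
        refine integral_mono (hint _) (hint _) fun ω => ?_
        by_cases h : ω ∈ noneOf D 𝓕
        · have h0 : ∀ T ∈ 𝓕, I T ω - μ.real (D T) = - μ.real (D T) := fun T hT => by
            simp [hI, h T hT]
          simp only
          rw [Set.indicator_of_mem h, Finset.sum_congr rfl h0, Finset.sum_neg_distrib, neg_sq]
        · simp only
          rw [Set.indicator_of_notMem h]
          positivity
    _ = _ := hvar
    _ ≤ _ := by
        refine Finset.sum_le_sum fun T hT => ?_
        rw [Finset.sum_filter]
        refine Finset.sum_le_sum fun T' hT' => ?_
        split_ifs with h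
        · rw [hμ, real_inter_eq_mul (E T) (hD T hT) ((hD T' hT').mono ?_), sub_self]
          intro e he he'
          exact Finset.disjoint_left.1 h he' he
        · have : 0 ≤ μ.real (D T) * μ.real (D T') := by positivity
          linarith

variable [DecidableEq τ]

/-- The sum of `p_T p_T' + P(D_T ∩ D_T')` over dependent pairs of distinct indices. -/
noncomputable def dependence (D : τ → Set (Sym2 (Fin n) → Bool))
    (E : τ → Finset (Sym2 (Fin n))) (𝓕 : Finset τ) : ℝ :=
  ∑ T ∈ 𝓕, ∑ T' ∈ 𝓕 with T' ≠ T ∧ ¬ Disjoint (E T) (E T'),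
    ((erdosRenyi n (1 / 2)).real (D T) * (erdosRenyi n (1 / 2)).real (D T')
      + (erdosRenyi n (1 / 2)).real (D T ∩ D T'))

theorem dependence_mono (D : τ → Set (Sym2 (Fin n) → Bool))
    (E : τ → Finset (Sym2 (Fin n))) {𝓖 𝓕 : Finset τ} (h : 𝓖 ⊆ 𝓕) :
    dependence D E 𝓖 ≤ dependence D E 𝓕 := by
  unfold dependence
  refine (Finset.sum_le_sum fun T _ => ?_).trans
    (Finset.sum_le_sum_of_subset_of_nonneg h fun T _ _ => ?_)
  · exact Finset.sum_le_sum_of_subset_of_nonneg (Finset.filter_subset_filter _ h)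
      fun T _ _ => by positivity
  · exact Finset.sum_nonneg fun T _ => by positivity

theorem abs_real_noneOf_sub_prod_le (D : τ → Set (Sym2 (Fin n) → Bool))
    (E : τ → Finset (Sym2 (Fin n))) (𝓕 : Finset τ)
    (hD : ∀ T ∈ 𝓕, DeterminedBy (D T) (E T : Set (Sym2 (Fin n)))) :
    |(erdosRenyi n (1 / 2)).real (noneOf D 𝓕)
      - ∏ T ∈ 𝓕, (1 - (erdosRenyi n (1 / 2)).real (D T))| ≤ dependence D E 𝓕 := by
  induction 𝓕 using Finset.induction_on with
  | empty => simp only [noneOf, dependence, Finset.notMem_empty, false_imp_iff, implies_true,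
      Set.ofPred_true, probReal_univ, Finset.prod_empty, Finset.sum_empty, sub_self, abs_zero,
      le_refl]
  | insert T 𝓕 hT ih =>
    have ih := ih fun T' hT' => hD T' (Finset.mem_insert_of_mem hT')
    set P := fun S => (erdosRenyi n (1 / 2)).real S with hP
    set p : τ → Prop := fun T' => ¬ Disjoint (E T) (E T') with hp
    set 𝓘 := 𝓕.filter fun T' => ¬ p T' with h𝓘
    have hins : P (noneOf D (insert T 𝓕)) = P (noneOf D 𝓕) - P (D T ∩ noneOf D 𝓕) := by
      have h1 : noneOf D (insert T 𝓕) = noneOf D 𝓕 \ D T := by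
        ext ω
        simp [noneOf, and_comm]
      rw [h1, hP]
      have := measureReal_sdiff_add_inter (μ := erdosRenyi n (1 / 2)) (s := noneOf D 𝓕)
        (measurableSet_coins (D T))
      rw [Set.inter_comm (D T)]
      simp only
      linarith
    have hind : P (D T ∩ noneOf D 𝓘) = P (D T) * P (noneOf D 𝓘) := by
      refine real_inter_eq_mul (E T) (hD T (Finset.mem_insert_self _ _)) ?_
      refine determinedBy_noneOf fun T' hT' => ?_
      rw [h𝓘, Finset.mem_filter, hp, not_not] at hT'
      refine (hD T' (Finset.mem_insert_of_mem hT'.1)).mono ?_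
      intro e he he'
      exact Finset.disjoint_left.1 hT'.2 he' he
    have hle : ∀ A, P (A ∩ noneOf D 𝓕) ≤ P (A ∩ noneOf D 𝓘) := fun A =>
      measureReal_mono (Set.inter_subset_inter_right _ fun ω hω T' hT' =>
        hω T' (Finset.mem_of_mem_filter T' hT'))
    have hle1 := hle (D T)
    have hle2 := hle Set.univ
    have hge1 := real_inter_noneOf_filter_le D 𝓕 p (D T)
    have hge2 := real_inter_noneOf_filter_le D 𝓕 p Set.univ
    simp only [Set.univ_inter] at hge2 hle2
    set S1 := ∑ T' ∈ 𝓕 with p T', P (D T ∩ D T') with hS1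
    set S2 := ∑ T' ∈ 𝓕 with p T', P (D T') with hS2
    change P (D T ∩ noneOf D 𝓘) ≤ P (D T ∩ noneOf D 𝓕) + S1 at hge1
    change P (noneOf D 𝓘) ≤ P (noneOf D 𝓕) + S2 at hge2
    have hp0 : 0 ≤ P (D T) := measureReal_nonneg
    have hp1 : P (D T) ≤ 1 := measureReal_le_one
    have hS10 : 0 ≤ S1 := Finset.sum_nonneg fun _ _ => measureReal_nonneg
    have hS20 : 0 ≤ S2 := Finset.sum_nonneg fun _ _ => measureReal_nonneg
    have hstep : |P (noneOf D (insert T 𝓕)) - (1 - P (D T)) * P (noneOf D 𝓕)|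
        ≤ P (D T) * S2 + S1 := by
      have h3 := mul_le_mul_of_nonneg_left hge2 hp0
      have h4 := mul_le_mul_of_nonneg_left hle2 hp0
      have h5 := mul_nonneg hp0 hS20
      rw [hins, abs_le]
      constructor <;> nlinarith
    have hdep : P (D T) * S2 + S1 + dependence D E 𝓕 ≤ dependence D E (insert T 𝓕) := by
      rw [dependence, dependence, Finset.sum_insert hT]
      refine add_le_add ?_ (Finset.sum_le_sum fun T' hT' => ?_)
      · rw [hS1, hS2, Finset.mul_sum, ← Finset.sum_add_distrib]
        refine Finset.sum_le_sum_of_subset_of_nonneg (fun T' hT' => ?_)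
          fun T' _ _ => by positivity
        rw [Finset.mem_filter] at hT' ⊢
        exact ⟨Finset.mem_insert_of_mem hT'.1, fun h => hT (h ▸ hT'.1), hT'.2⟩
      · exact Finset.sum_le_sum_of_subset_of_nonneg
          (Finset.filter_subset_filter _ (Finset.subset_insert _ _))
          fun T' _ _ => by positivity
    rw [Finset.prod_insert hT]
    have hmul : |(1 - P (D T)) * (P (noneOf D 𝓕) - ∏ T' ∈ 𝓕, (1 - P (D T')))|
        ≤ dependence D E 𝓕 := by
      rw [abs_mul, abs_of_nonneg (by linarith)]
      exact (mul_le_of_le_one_left (abs_nonneg _) (by linarith)).trans ih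
    have := abs_add_le (P (noneOf D (insert T 𝓕)) - (1 - P (D T)) * P (noneOf D 𝓕))
      ((1 - P (D T)) * (P (noneOf D 𝓕) - ∏ T' ∈ 𝓕, (1 - P (D T'))))
    rw [show P (noneOf D (insert T 𝓕)) - (1 - P (D T)) * P (noneOf D 𝓕)
      + (1 - P (D T)) * (P (noneOf D 𝓕) - ∏ T' ∈ 𝓕, (1 - P (D T')))
      = P (noneOf D (insert T 𝓕)) - (1 - P (D T)) * ∏ T' ∈ 𝓕, (1 - P (D T')) by ring] at this
    linarith

end LocalEvents

/-! ### Independent sets and induced complete bipartite graphs as local events -/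

section GraphEvents

variable {n : ℕ}

/-- The pairs of distinct vertices of `T`. -/
def edgesIn (T : Finset (Fin n)) : Finset (Sym2 (Fin n)) := T.offDiag.image Sym2.mk.uncurry

theorem mk_mem_edgesIn {T : Finset (Fin n)} {u v : Fin n} :
    s(u, v) ∈ edgesIn T ↔ u ∈ T ∧ v ∈ T ∧ u ≠ v := by
  simp only [edgesIn, Finset.mem_image, Finset.mem_offDiag, Prod.exists,
    Function.uncurry_apply_pair, Sym2.eq_iff]
  constructor
  · rintro ⟨a, b, ⟨ha, hb, hab⟩, ⟨rfl, rfl⟩ | ⟨rfl, rfl⟩⟩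
    · exact ⟨ha, hb, hab⟩
    · exact ⟨hb, ha, hab.symm⟩
  · rintro h
    exact ⟨u, v, h, Or.inl ⟨rfl, rfl⟩⟩

theorem card_edgesIn (T : Finset (Fin n)) : (edgesIn T).card = T.card.choose 2 :=
  Sym2.card_image_offDiag T

theorem edgesIn_inter (T T' : Finset (Fin n)) : edgesIn T ∩ edgesIn T' = edgesIn (T ∩ T') := by
  ext e
  induction e using Sym2.ind with
  | _ u v =>
    simp only [Finset.mem_inter, mk_mem_edgesIn]
    tauto

theorem disjoint_edgesIn {T T' : Finset (Fin n)} :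
    Disjoint (edgesIn T) (edgesIn T') ↔ (T ∩ T').card < 2 := by
  rw [Finset.disjoint_iff_inter_eq_empty, edgesIn_inter, ← Finset.card_eq_zero, card_edgesIn,
    Nat.choose_eq_zero_iff]

theorem card_edgesIn_sdiff (T T' : Finset (Fin n)) :
    (edgesIn T' \ edgesIn T).card = T'.card.choose 2 - (T ∩ T').card.choose 2 := by
  rw [Finset.card_sdiff, edgesIn_inter, card_edgesIn, card_edgesIn]

/-- The coin pattern of the complete bipartite graph between `A` and its complement. -/
def cutPattern (A : Finset (Fin n)) : Sym2 (Fin n) → Bool :=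
  Sym2.lift ⟨fun u v => xor (decide (u ∈ A)) (decide (v ∈ A)), fun _ _ => Bool.xor_comm _ _⟩

@[simp] theorem cutPattern_mk (A : Finset (Fin n)) (u v : Fin n) :
    cutPattern A s(u, v) = xor (decide (u ∈ A)) (decide (v ∈ A)) := rfl

theorem mem_patternSet_edgesIn {T : Finset (Fin n)} {c : Sym2 (Fin n) → Bool}
    {ω : Sym2 (Fin n) → Bool} : ω ∈ patternSet (edgesIn T) c ↔
      ∀ u ∈ T, ∀ v ∈ T, u ≠ v → ω s(u, v) = c s(u, v) := by
  constructor
  · intro h u hu v hv huv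
    exact h _ (mk_mem_edgesIn.2 ⟨hu, hv, huv⟩)
  · intro h e
    induction e using Sym2.ind with
    | _ u v =>
      intro he
      obtain ⟨hu, hv, huv⟩ := mk_mem_edgesIn.1 he
      exact h u hu v hv huv

/-- The first classes of the bipartitions under consideration: all nontrivial ones if `b` is true,
only the trivial one with an empty first class otherwise. -/
def colorings (b : Bool) (T : Finset (Fin n)) : Finset (Finset (Fin n)) :=
  if b then T.powerset.filter fun A => A ≠ ∅ ∧ A ≠ T else {∅}

/-- `T` induces a complete bipartite graph (if `b` is true) or an empty graph (otherwise). -/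
def cutEvent (b : Bool) (T : Finset (Fin n)) : Set (Sym2 (Fin n) → Bool) :=
  ⋃ A ∈ colorings b T, patternSet (edgesIn T) (cutPattern A)

theorem mem_cutEvent {b : Bool} {T : Finset (Fin n)} {ω : Sym2 (Fin n) → Bool} :
    ω ∈ cutEvent b T ↔ ∃ A ∈ colorings b T, ω ∈ patternSet (edgesIn T) (cutPattern A) := by
  simp [cutEvent]

theorem graphOf_adj {ω : Sym2 (Fin n) → Bool} {u v : Fin n} :
    (graphOf n ω).Adj u v ↔ ω s(u, v) = true ∧ u ≠ v := by
  simp [graphOf]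

theorem mem_cutEvent_false {T : Finset (Fin n)} {ω : Sym2 (Fin n) → Bool} :
    ω ∈ cutEvent false T ↔ IsIndepFinset (graphOf n ω) T := by
  simp only [mem_cutEvent, colorings, Bool.false_eq_true, if_false, Finset.mem_singleton,
    exists_eq_left, mem_patternSet_edgesIn, IsIndepFinset, graphOf_adj, cutPattern_mk]
  refine forall₄_congr fun u _ v _ => ?_
  cases ω s(u, v) <;> simp

theorem mem_cutEvent_true {T : Finset (Fin n)} {ω : Sym2 (Fin n) → Bool} :
    ω ∈ cutEvent true T ↔ ∃ A B, IsInducedCompleteBipartite (graphOf n ω) T A B := by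
  simp only [mem_cutEvent, colorings, if_true, Finset.mem_filter, Finset.mem_powerset,
    mem_patternSet_edgesIn]
  constructor
  · rintro ⟨A, ⟨hAT, hA, hA'⟩, h⟩
    refine ⟨A, T \ A, Finset.nonempty_iff_ne_empty.2 hA, ?_, Finset.disjoint_sdiff, ?_, ?_⟩
    · rw [Finset.sdiff_nonempty]
      exact fun h => hA' (hAT.antisymm h)
    · rw [← Finset.coe_union, Finset.union_sdiff_of_subset hAT]
    · intro u hu v hv
      rw [graphOf_adj, Finset.mem_sdiff, Finset.mem_sdiff]
      by_cases huv : u = v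
      · subst huv
        tauto
      · rw [h u hu v hv huv, cutPattern_mk]
        by_cases h1 : u ∈ A <;> by_cases h2 : v ∈ A <;> simp [h1, h2, hu, hv, huv]
  · rintro ⟨A, B, hA, ⟨b, hb⟩, hAB, hT, h⟩
    have hT : A ∪ B = T := Finset.coe_injective (by rw [Finset.coe_union]; exact hT)
    have hmem : ∀ u ∈ T, (u ∈ B ↔ u ∉ A) := by
      intro u hu
      rw [← hT, Finset.mem_union] at hu
      have hd : u ∈ A → u ∉ B := fun h => Finset.disjoint_left.1 hAB h
      tauto
    refine ⟨A, ⟨hT ▸ Finset.subset_union_left, hA.ne_empty, ?_⟩, ?_⟩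
    · rintro rfl
      have hbT : b ∈ A := by rw [← hT]; exact Finset.mem_union_right _ hb
      exact Finset.disjoint_left.1 hAB hbT hb
    · intro u hu v hv huv
      have := h u hu v hv
      rw [graphOf_adj, hmem u hu, hmem v hv] at this
      rw [cutPattern_mk, Bool.eq_iff_iff]
      by_cases h1 : u ∈ A <;> by_cases h2 : v ∈ A <;> simp_all

theorem determinedBy_cutEvent (b : Bool) (T : Finset (Fin n)) :
    DeterminedBy (cutEvent b T) (edgesIn T : Set (Sym2 (Fin n))) := by
  intro ω ω' h hω
  rw [mem_cutEvent] at hω ⊢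
  obtain ⟨A, hA, hω⟩ := hω
  exact ⟨A, hA, determinedBy_patternSet _ _ subset_rfl ω ω' h hω⟩

theorem card_colorings_le (b : Bool) (T : Finset (Fin n)) :
    (colorings b T).card ≤ 2 ^ (b.toNat * T.card) := by
  cases b
  · simp [colorings]
  · simp only [colorings, if_true, Bool.toNat_true, one_mul]
    exact (Finset.card_filter_le _ _).trans_eq (Finset.card_powerset _)

/-- An upper bound for the probability of `cutEvent b T` with `T.card = m`. -/
noncomputable def cutWeight (b : Bool) (m : ℕ) : ℝ := 2 ^ (b.toNat * m) / 2 ^ (m.choose 2)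

theorem cutWeight_pos (b : Bool) (m : ℕ) : 0 < cutWeight b m := by
  unfold cutWeight; positivity

theorem real_cutEvent_le (b : Bool) (T : Finset (Fin n)) :
    (erdosRenyi n (1 / 2)).real (cutEvent b T) ≤ cutWeight b T.card := by
  refine (measureReal_biUnion_finset_le _ _).trans ?_
  simp only [real_patternSet, card_edgesIn, Finset.sum_const, nsmul_eq_mul]
  rw [cutWeight, one_div, inv_pow, div_eq_mul_inv]
  gcongr
  exact_mod_cast card_colorings_le b T

theorem cutWeight_le_real_cutEvent (b : Bool) {T : Finset (Fin n)} (hT : 2 ≤ T.card) :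
    cutWeight b T.card / 4 ≤ (erdosRenyi n (1 / 2)).real (cutEvent b T) := by
  obtain ⟨t, ht⟩ := Finset.card_pos.1 (by omega : 0 < T.card)
  set 𝒞 := (colorings b T).filter fun A => t ∉ A with h𝒞
  have hcard : (2 : ℝ) ^ (b.toNat * T.card) / 4 ≤ 𝒞.card := by
    cases b
    · have : 𝒞 = {∅} := by
        ext A
        simp only [h𝒞, colorings, Finset.mem_filter, Bool.false_eq_true, if_false,
          Finset.mem_singleton]
        constructor
        · exact fun h => h.1
        · rintro rfl; simp
      rw [this]
      norm_num
    · have : 𝒞 = (T.erase t).powerset.erase ∅ := by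
        ext A
        simp only [h𝒞, colorings, Finset.mem_filter, if_true, Finset.mem_powerset,
          Finset.mem_erase, Finset.subset_erase]
        constructor
        · tauto
        · rintro ⟨h1, h2, h3⟩
          exact ⟨⟨h2, h1, fun h => h3 (h ▸ ht)⟩, h3⟩
      rw [this, Finset.card_erase_of_mem (by simp), Finset.card_powerset,
        Finset.card_erase_of_mem ht]
      obtain ⟨m, hm⟩ := Nat.exists_eq_add_of_le hT
      rw [hm, Nat.cast_sub Nat.one_le_two_pow, show 2 + m - 1 = m + 1 by omega]
      have : (1 : ℝ) ≤ 2 ^ m := one_le_pow₀ (by norm_num)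
      simp only [Bool.toNat_true, one_mul]
      push_cast
      rw [pow_add, pow_succ 2 m]
      linarith
  have hdisj : Set.PairwiseDisjoint (𝒞 : Set (Finset (Fin n)))
      fun A => patternSet (edgesIn T) (cutPattern A) := by
    have hsub : ∀ A ∈ 𝒞, ∀ A' ∈ 𝒞, ∀ ω ∈ patternSet (edgesIn T) (cutPattern A),
        ω ∈ patternSet (edgesIn T) (cutPattern A') → A ⊆ A' := by
      intro A hA A' hA' ω hω hω' u hu
      rw [mem_patternSet_edgesIn] at hω hω'
      rw [h𝒞, Finset.mem_filter] at hA hA'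
      have huT : u ∈ T := by
        have := hA.1
        cases b
        · simp only [colorings, Bool.false_eq_true, if_false, Finset.mem_singleton] at this
          simp [this] at hu
        · simp only [colorings, if_true, Finset.mem_filter, Finset.mem_powerset] at this
          exact this.1 hu
      have hut : u ≠ t := fun h => hA.2 (h ▸ hu)
      have h1 := hω u huT t ht hut
      have h2 := hω' u huT t ht hut
      rw [h1] at h2
      simpa [hu, hA.2, hA'.2] using h2
    intro A hA A' hA' hne
    rw [Function.onFun, Set.disjoint_left]
    exact fun ω hω hω' => hne ((hsub A hA A' hA' ω hω hω').antisymm (hsub A' hA' A hA ω hω' hω))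
  calc cutWeight b T.card / 4
      = (2 : ℝ) ^ (b.toNat * T.card) / 4 * (1 / 2) ^ (T.card.choose 2) := by
        rw [cutWeight, one_div, inv_pow]
        ring
    _ ≤ 𝒞.card * (1 / 2) ^ (T.card.choose 2) := by gcongr
    _ = (erdosRenyi n (1 / 2)).real (⋃ A ∈ 𝒞, patternSet (edgesIn T) (cutPattern A)) := by
        rw [measureReal_biUnion_finset hdisj fun _ _ => measurableSet_coins _]
        simp only [real_patternSet, card_edgesIn, Finset.sum_const, nsmul_eq_mul]
    _ ≤ _ := by
        refine measureReal_mono (Set.biUnion_subset_biUnion_left ?_)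
        exact Finset.filter_subset _ _

/-- A bound for the conditional probability of `cutEvent b T'` given `cutEvent b' T`, where
`T'.card = m` and `(T ∩ T').card = l`. -/
noncomputable def condWeight (b : Bool) (m l : ℕ) : ℝ :=
  2 ^ (b.toNat * (m - l)) / 2 ^ (m.choose 2 - l.choose 2)

theorem condWeight_pos (b : Bool) (m l : ℕ) : 0 < condWeight b m l := by
  unfold condWeight; positivity

theorem cutWeight_le_two_mul_condWeight (b : Bool) {m l : ℕ} (hl : 2 ≤ l) (hlm : l ≤ m) :
    cutWeight b m ≤ 2 * condWeight b m l := by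
  have h1 : l ≤ l.choose 2 + 1 := by
    induction l, hl using Nat.le_induction with
    | base => decide
    | succ l hl ih =>
      have := ih (by omega)
      rw [Nat.choose_succ_succ' l 1, Nat.choose_one_right]
      omega
  have h2 : l.choose 2 ≤ m.choose 2 := Nat.choose_le_choose 2 hlm
  have h3 : m.choose 2 = (m.choose 2 - l.choose 2) + l.choose 2 := by omega
  have h4 : b.toNat * m = b.toNat * (m - l) + b.toNat * l := by
    rw [← mul_add]; congr 1; omega
  have h5 : (2 : ℝ) ^ (b.toNat * l) ≤ 2 * 2 ^ (l.choose 2) := by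
    rw [← pow_succ']
    refine pow_le_pow_right₀ (by norm_num) (le_trans ?_ h1)
    have := b.toNat_le
    nlinarith
  rw [cutWeight, condWeight, h4, h3, pow_add, pow_add]
  rw [Nat.add_sub_cancel, div_le_iff₀ (by positivity)]
  calc _ ≤ (2 : ℝ) ^ (b.toNat * (m - l)) * (2 * 2 ^ (l.choose 2)) := by gcongr
    _ = _ := by field_simp

theorem cutEvent_inter_subset {b b' : Bool} (hb : b = true → b' = true) (T T' : Finset (Fin n)) :
    cutEvent b T ∩ cutEvent b' T' ⊆ ⋃ A ∈ colorings b T,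
      ⋃ B ∈ (if b' then (T' \ T).powerset else {∅}), patternSet (edgesIn T) (cutPattern A)
        ∩ patternSet (edgesIn T' \ edgesIn T) (cutPattern (A ∩ T' ∪ B)) := by
  rintro ω ⟨h, h'⟩
  obtain ⟨A, hA, hω⟩ := mem_cutEvent.1 h
  obtain ⟨A', hA', hω'⟩ := mem_cutEvent.1 h'
  refine Set.mem_biUnion hA ?_
  cases b'
  · have hbf : b = false := by cases b <;> simp_all
    subst hbf
    simp only [colorings, Bool.false_eq_true, if_false, Finset.mem_singleton] at hA hA'
    subst hA hA'
    refine Set.mem_biUnion (x := ∅) (by simp) ⟨hω, fun e he => ?_⟩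
    simpa using hω' e (Finset.sdiff_subset he)
  · have hAT : A ⊆ T := by
      cases b
      · simp only [colorings, Bool.false_eq_true, if_false, Finset.mem_singleton] at hA
        simp [hA]
      · simp only [colorings, if_true, Finset.mem_filter, Finset.mem_powerset] at hA
        exact hA.1
    have hAT' : A' ⊆ T' := by
      simp only [colorings, if_true, Finset.mem_filter, Finset.mem_powerset] at hA'
      exact hA'.1
    obtain ⟨A'', hA'', hω'', hagree⟩ : ∃ A'' ⊆ T',
        ω ∈ patternSet (edgesIn T') (cutPattern A'') ∧ A'' ∩ T = A ∩ T' := by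
      rw [mem_patternSet_edgesIn] at hω hω'
      by_cases hsame : ∀ u ∈ T ∩ T', (u ∈ A ↔ u ∈ A')
      · refine ⟨A', hAT', mem_patternSet_edgesIn.2 hω', ?_⟩
        ext u
        have := hsame u
        have := @hAT u
        have := @hAT' u
        simp only [Finset.mem_inter] at *
        tauto
      · push Not at hsame
        obtain ⟨u, hu, huA⟩ := hsame
        rw [Finset.mem_inter] at hu
        have hopp : ∀ v ∈ T ∩ T', (v ∈ A ↔ v ∉ A') := by
          intro v hv
          rw [Finset.mem_inter] at hv
          by_cases huv : u = v
          · subst huv; tauto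
          · have h1 := hω u hu.1 v hv.1 huv
            have h2 := hω' u hu.2 v hv.2 huv
            rw [h1] at h2
            simp only [cutPattern_mk] at h2
            by_cases c1 : u ∈ A <;> by_cases c2 : v ∈ A <;> by_cases c3 : u ∈ A' <;>
              by_cases c4 : v ∈ A' <;> simp_all
        refine ⟨T' \ A', Finset.sdiff_subset, mem_patternSet_edgesIn.2 ?_, ?_⟩
        · intro v hv w hw hvw
          rw [hω' v hv w hw hvw]
          by_cases c1 : v ∈ A' <;> by_cases c2 : w ∈ A' <;> simp [c1, c2, hv, hw]
        · ext v
          have := hopp v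
          have := @hAT v
          simp only [Finset.mem_inter, Finset.mem_sdiff] at *
          tauto
    refine Set.mem_biUnion (x := A'' \ T) ?_ ⟨hω, ?_⟩
    · rw [if_pos rfl, Finset.mem_coe, Finset.mem_powerset]
      exact Finset.sdiff_subset_sdiff hA'' subset_rfl
    · have : A ∩ T' ∪ A'' \ T = A'' := by
        rw [← hagree, Finset.union_comm, Finset.sdiff_union_inter]
      rw [this]
      exact fun e he => hω'' e (Finset.sdiff_subset he)

theorem real_cutEvent_inter_le {b b' : Bool} (hb : b = true → b' = true)
    (T T' : Finset (Fin n)) :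
    (erdosRenyi n (1 / 2)).real (cutEvent b T ∩ cutEvent b' T')
      ≤ cutWeight b T.card * condWeight b' T'.card (T ∩ T').card := by
  have hcard : ((if b' then (T' \ T).powerset else {∅} : Finset (Finset (Fin n))).card : ℝ)
      = 2 ^ (b'.toNat * (T'.card - (T ∩ T').card)) := by
    cases b'
    · simp
    · simp [Finset.card_sdiff]
  have hterm : ∀ A B : Finset (Fin n), (erdosRenyi n (1 / 2)).real
      (patternSet (edgesIn T) (cutPattern A)
        ∩ patternSet (edgesIn T' \ edgesIn T) (cutPattern (A ∩ T' ∪ B)))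
      = (1 / 2) ^ (T.card.choose 2)
        * (1 / 2) ^ (T'.card.choose 2 - (T ∩ T').card.choose 2) := by
    intro A B
    rw [real_patternSet_inter, real_patternSet, card_edgesIn, card_edgesIn_sdiff]
    refine determinedBy_patternSet _ _ ?_
    intro e he he'
    exact (Finset.mem_sdiff.1 he).2 he'
  refine (measureReal_mono (cutEvent_inter_subset hb T T') (measure_ne_top _ _)).trans ?_
  refine (measureReal_biUnion_finset_le _ _).trans ?_
  calc _ ≤ ∑ A ∈ colorings b T, ∑ B ∈ (if b' then (T' \ T).powerset else {∅}),
        (1 / 2 : ℝ) ^ (T.card.choose 2)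
          * (1 / 2) ^ (T'.card.choose 2 - (T ∩ T').card.choose 2) := by
        refine Finset.sum_le_sum fun A _ => (measureReal_biUnion_finset_le _ _).trans ?_
        simp only [hterm]
        exact le_rfl
    _ = (colorings b T).card * (1 / 2) ^ (T.card.choose 2)
        * (2 ^ (b'.toNat * (T'.card - (T ∩ T').card))
          * (1 / 2) ^ (T'.card.choose 2 - (T ∩ T').card.choose 2)) := by
        simp only [Finset.sum_const, nsmul_eq_mul, hcard]
        ring
    _ ≤ 2 ^ (b.toNat * T.card) * (1 / 2) ^ (T.card.choose 2)
        * (2 ^ (b'.toNat * (T'.card - (T ∩ T').card))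
          * (1 / 2) ^ (T'.card.choose 2 - (T ∩ T').card.choose 2)) := by
        gcongr
        exact_mod_cast card_colorings_le b T
    _ = _ := by
        simp only [cutWeight, condWeight, inv_pow, div_eq_mul_inv, one_mul]

end GraphEvents

/-! ### Overlap sums -/

section Overlap

variable {n : ℕ}

/-- The order of magnitude of the expected number of `m`-sets `T` for which `cutEvent b T`
occurs. -/
noncomputable def expectedCuts (b : Bool) (n m : ℕ) : ℝ := n.choose m * cutWeight b m

/-- A bound for the expected number of further `m`-sets `T'` meeting a given set `T` in at least
two vertices for which `cutEvent b T'` occurs, given that `T` carries such an event. -/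
noncomputable def overlapSum (b : Bool) (n m : ℕ) : ℝ :=
  ∑ l ∈ Finset.Ico 2 m, (m.choose l : ℝ) * n.choose (m - l) * condWeight b m l

theorem expectedCuts_nonneg (b : Bool) (n m : ℕ) : 0 ≤ expectedCuts b n m :=
  mul_nonneg (Nat.cast_nonneg _) (cutWeight_pos b m).le

theorem overlapSum_nonneg (b : Bool) (n m : ℕ) : 0 ≤ overlapSum b n m :=
  Finset.sum_nonneg fun l _ => mul_nonneg (by positivity) (condWeight_pos b m l).le

theorem card_filter_card_inter_le (T : Finset (Fin n)) (m l : ℕ) :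
    ((Finset.powersetCard m Finset.univ).filter fun T' => (T ∩ T').card = l).card
      ≤ T.card.choose l * n.choose (m - l) := by
  calc _ ≤ (Finset.powersetCard l T ×ˢ
        Finset.powersetCard (m - l) (Finset.univ : Finset (Fin n))).card := by
        refine Finset.card_le_card_of_injOn (fun T' => (T ∩ T', T' \ T)) ?_ ?_
        · intro T' hT'
          simp only [Finset.coe_filter, Finset.mem_powersetCard, Set.mem_ofPred_eq] at hT'
          simp only [Finset.coe_product, Set.mem_prod, Finset.mem_coe, Finset.mem_powersetCard]
          refine ⟨⟨Finset.inter_subset_left, hT'.2⟩, Finset.subset_univ _, ?_⟩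
          rw [Finset.card_sdiff, hT'.1.2, hT'.2]
        · intro T' _ T'' _ h
          simp only [Prod.mk.injEq] at h
          rw [← Finset.sdiff_union_inter T' T, ← Finset.sdiff_union_inter T'' T, h.2,
            Finset.inter_comm T', Finset.inter_comm T'', h.1]
    _ = _ := by simp

theorem sum_condWeight_le (b : Bool) {m : ℕ} {T : Finset (Fin n)} (hT : T.card ≤ m) :
    ∑ T' ∈ Finset.powersetCard m (Finset.univ : Finset (Fin n)) with
        T' ≠ T ∧ ¬ Disjoint (edgesIn T) (edgesIn T'), condWeight b m (T ∩ T').card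
      ≤ overlapSum b n m := by
  rw [← Finset.sum_fiberwise_of_maps_to (t := Finset.Ico 2 m) (g := fun T' => (T ∩ T').card)]
  · refine Finset.sum_le_sum fun l hl => ?_
    have hcongr : ∀ T' ∈ (((Finset.powersetCard m (Finset.univ : Finset (Fin n))).filter fun T' =>
        T' ≠ T ∧ ¬ Disjoint (edgesIn T) (edgesIn T')).filter fun T' => (T ∩ T').card = l),
        condWeight b m (T ∩ T').card = condWeight b m l := by
      intro T' hT'
      rw [(Finset.mem_filter.1 hT').2]
    rw [Finset.sum_congr rfl hcongr, Finset.sum_const, nsmul_eq_mul]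
    refine mul_le_mul_of_nonneg_right ?_ (condWeight_pos b m l).le
    have h1 := card_filter_card_inter_le T m l
    have h2 : T.card.choose l ≤ m.choose l := Nat.choose_le_choose l hT
    have h3 := Finset.card_le_card (Finset.filter_subset_filter (fun T' => (T ∩ T').card = l)
      (Finset.filter_subset (fun T' => T' ≠ T ∧ ¬ Disjoint (edgesIn T) (edgesIn T'))
        (Finset.powersetCard m (Finset.univ : Finset (Fin n)))))
    exact_mod_cast h3.trans (h1.trans (Nat.mul_le_mul_right _ h2))
  · intro T' hT'
    simp only [Finset.mem_filter, Finset.mem_powersetCard, disjoint_edgesIn, not_lt] at hT'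
    obtain ⟨⟨-, hT'm⟩, hne, h2⟩ := hT'
    rw [Finset.mem_Ico]
    refine ⟨h2, lt_of_le_of_ne ?_ fun h => hne ?_⟩
    · exact hT'm ▸ Finset.card_le_card Finset.inter_subset_right
    · have hsub : T ∩ T' = T' :=
        Finset.eq_of_subset_of_card_le Finset.inter_subset_right (by rw [h, hT'm])
      exact Finset.eq_of_subset_of_card_le (Finset.inter_eq_right.1 hsub) (by rw [hT'm]; exact hT)

theorem sum_dependent_pairs_le {b b' : Bool} (hb : b = true → b' = true) {k m : ℕ} (hkm : k ≤ m) :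
    ∑ T ∈ Finset.powersetCard k (Finset.univ : Finset (Fin n)),
      ∑ T' ∈ Finset.powersetCard m (Finset.univ : Finset (Fin n)) with
        T' ≠ T ∧ ¬ Disjoint (edgesIn T) (edgesIn T'),
        ((erdosRenyi n (1 / 2)).real (cutEvent b T) * (erdosRenyi n (1 / 2)).real (cutEvent b' T')
          + (erdosRenyi n (1 / 2)).real (cutEvent b T ∩ cutEvent b' T'))
      ≤ 3 * expectedCuts b n k * overlapSum b' n m := by
  calc _ ≤ ∑ T ∈ Finset.powersetCard k (Finset.univ : Finset (Fin n)),
      3 * cutWeight b k * overlapSum b' n m := by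
        refine Finset.sum_le_sum fun T hT => ?_
        have hTk : T.card = k := (Finset.mem_powersetCard.1 hT).2
        have h := sum_condWeight_le (n := n) b' (hTk.le.trans hkm)
        refine le_trans ?_ (mul_le_mul_of_nonneg_left h
          (mul_pos three_pos (cutWeight_pos b k)).le)
        rw [Finset.mul_sum]
        refine Finset.sum_le_sum fun T' hT' => ?_
        rw [Finset.mem_filter, Finset.mem_powersetCard, disjoint_edgesIn, not_lt] at hT'
        obtain ⟨⟨-, hT'm⟩, -, hl⟩ := hT'
        have h1 := real_cutEvent_inter_le hb T T'
        have h2 := real_cutEvent_le b T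
        have h3 := real_cutEvent_le b' T'
        have h4 := cutWeight_le_two_mul_condWeight b' hl
          (hT'm ▸ Finset.card_le_card Finset.inter_subset_right)
        rw [hTk] at h1 h2
        rw [hT'm] at h1 h3
        have h5 := mul_le_mul h2 (h3.trans h4) measureReal_nonneg (cutWeight_pos b k).le
        linarith
    _ = _ := by
        rw [Finset.sum_const, nsmul_eq_mul, Finset.card_powersetCard, Finset.card_univ,
          Fintype.card_fin, expectedCuts]
        ring

theorem sum_real_cutEvent_le (b : Bool) (n m : ℕ) :
    ∑ T ∈ Finset.powersetCard m (Finset.univ : Finset (Fin n)),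
      (erdosRenyi n (1 / 2)).real (cutEvent b T) ≤ expectedCuts b n m := by
  calc _ ≤ ∑ T ∈ Finset.powersetCard m (Finset.univ : Finset (Fin n)), cutWeight b m := by
        refine Finset.sum_le_sum fun T hT => ?_
        rw [← (Finset.mem_powersetCard.1 hT).2]
        exact real_cutEvent_le b T
    _ = _ := by simp [expectedCuts]

theorem expectedCuts_le_sum_real_cutEvent (b : Bool) (n : ℕ) {m : ℕ} (hm : 2 ≤ m) :
    expectedCuts b n m / 4 ≤ ∑ T ∈ Finset.powersetCard m (Finset.univ : Finset (Fin n)),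
      (erdosRenyi n (1 / 2)).real (cutEvent b T) := by
  calc expectedCuts b n m / 4
      = ∑ T ∈ Finset.powersetCard m (Finset.univ : Finset (Fin n)), cutWeight b m / 4 := by
        simp [expectedCuts, mul_div_assoc]
    _ ≤ _ := by
        refine Finset.sum_le_sum fun T hT => ?_
        have hT := (Finset.mem_powersetCard.1 hT).2
        rw [← hT]
        exact cutWeight_le_real_cutEvent b (by omega)

theorem expectedCuts_mul_real_noneOf_le (b : Bool) (n : ℕ) {m : ℕ} (hm : 2 ≤ m) :
    expectedCuts b n m * (erdosRenyi n (1 / 2)).real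
        (noneOf (cutEvent b) (Finset.powersetCard m (Finset.univ : Finset (Fin n))))
      ≤ 16 * (1 + 3 * overlapSum b n m) := by
  set q := (erdosRenyi n (1 / 2)).real
        (noneOf (cutEvent b) (Finset.powersetCard m (Finset.univ : Finset (Fin n))))
  have hq : 0 ≤ q := measureReal_nonneg
  have h := sq_sum_mul_real_noneOf_le (cutEvent b) edgesIn
    (Finset.powersetCard m (Finset.univ : Finset (Fin n))) fun T _ => determinedBy_cutEvent b T
  have hlow := expectedCuts_le_sum_real_cutEvent b n hm
  have hpair := sum_dependent_pairs_le (n := n) (b := b) (b' := b) id le_rfl (k := m)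
  have hsum := sum_real_cutEvent_le b n m
  have h0 := expectedCuts_nonneg b n m
  have hup : ∑ T ∈ Finset.powersetCard m (Finset.univ : Finset (Fin n)),
      ∑ T' ∈ Finset.powersetCard m (Finset.univ : Finset (Fin n)) with
        ¬ Disjoint (edgesIn T) (edgesIn T'),
        (erdosRenyi n (1 / 2)).real (cutEvent b T ∩ cutEvent b T')
      ≤ expectedCuts b n m + 3 * expectedCuts b n m * overlapSum b n m := by
    refine le_trans ?_ (add_le_add hsum hpair)
    rw [← Finset.sum_add_distrib]
    refine Finset.sum_le_sum fun T hT => ?_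
    calc _ ≤ ∑ T' ∈ insert T ((Finset.powersetCard m (Finset.univ : Finset (Fin n))).filter
          fun T' => T' ≠ T ∧ ¬ Disjoint (edgesIn T) (edgesIn T')),
          (erdosRenyi n (1 / 2)).real (cutEvent b T ∩ cutEvent b T') := by
          refine Finset.sum_le_sum_of_subset_of_nonneg (fun T' hT' => ?_)
            fun _ _ _ => measureReal_nonneg
          rw [Finset.mem_filter] at hT'
          rw [Finset.mem_insert, Finset.mem_filter]
          tauto
      _ ≤ _ := by
          rw [Finset.sum_insert (by simp), Set.inter_self]
          gcongr
          exact le_add_of_nonneg_left (by positivity)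
  rcases h0.eq_or_lt with h0 | h0
  · rw [← h0, zero_mul]
    have := overlapSum_nonneg b n m
    positivity
  · have h1 : (expectedCuts b n m / 4) ^ 2 * q
        ≤ expectedCuts b n m + 3 * expectedCuts b n m * overlapSum b n m := by
      refine le_trans ?_ (h.trans hup)
      gcongr
    refine le_of_mul_le_mul_left ?_ h0
    linarith

/-! ### Estimating the overlap sums -/

theorem two_mul_choose_two_add (a : ℕ) : 2 * a.choose 2 + a = a * a := by
  induction a with
  | zero => rfl
  | succ a ih =>
    rw [Nat.choose_succ_succ' a 1, Nat.choose_one_right]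
    linarith

theorem choose_sub_mul_pow_le {n m l : ℕ} (hl : l ≤ m) :
    n.choose (m - l) * (n - m) ^ l ≤ n.choose m * m ^ l := by
  induction l with
  | zero => simp
  | succ l ih =>
    have h1 := Nat.choose_succ_right_eq n (m - (l + 1))
    rw [show m - (l + 1) + 1 = m - l by omega] at h1
    calc n.choose (m - (l + 1)) * (n - m) ^ (l + 1)
        = n.choose (m - (l + 1)) * (n - m) * (n - m) ^ l := by ring
      _ ≤ n.choose (m - (l + 1)) * (n - (m - (l + 1))) * (n - m) ^ l := by gcongr; omega
      _ = n.choose (m - l) * (n - m) ^ l * (m - l) := by rw [← h1]; ring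
      _ ≤ n.choose m * m ^ l * m := by
          exact Nat.mul_le_mul (ih (by omega)) (by omega)
      _ = _ := by ring

theorem overlap_term_le_of_small (b : Bool) {n m l : ℕ} {x y : ℝ} (hy : 0 < y)
    (hy4 : y ^ 4 = 2 ^ m) (hlm : 2 * l ≤ m) (hnm : m < n)
    (hx : (m : ℝ) ^ 2 * y ≤ x * (n - m)) :
    (m.choose l : ℝ) * n.choose (m - l) * condWeight b m l ≤ expectedCuts b n m * x ^ l := by
  have hl : l ≤ m := by omega
  have hnm' : (0 : ℝ) < n - m := by
    rw [sub_pos]; exact_mod_cast hnm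
  have h1 : (m.choose l : ℝ) ≤ (m : ℝ) ^ l := by exact_mod_cast Nat.choose_le_pow m l
  have h2 : (n.choose (m - l) : ℝ) * (n - m) ^ l ≤ n.choose m * m ^ l := by
    have := choose_sub_mul_pow_le (n := n) hl
    rw [← Nat.cast_sub hnm.le]
    exact_mod_cast this
  have h3 : (2 : ℝ) ^ (l.choose 2) ≤ y ^ l := by
    refine (pow_le_pow_iff_left₀ (by positivity) (by positivity) (by norm_num : 4 ≠ 0)).1 ?_
    rw [← pow_mul y, mul_comm l 4, pow_mul y, hy4, ← pow_mul, ← pow_mul]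
    refine pow_le_pow_right₀ (by norm_num) ?_
    have := two_mul_choose_two_add l
    nlinarith
  have h4 : condWeight b m l ≤ cutWeight b m * 2 ^ (l.choose 2) := by
    have h5 : l.choose 2 ≤ m.choose 2 := Nat.choose_le_choose 2 hl
    have h6 : (2 : ℝ) ^ (m.choose 2) = 2 ^ (m.choose 2 - l.choose 2) * 2 ^ (l.choose 2) := by
      rw [← pow_add, Nat.sub_add_cancel h5]
    rw [condWeight, cutWeight, h6, div_mul_eq_mul_div, mul_div_mul_right _ _ (by positivity)]
    gcongr
    · norm_num
    · omega
  calc (m.choose l : ℝ) * n.choose (m - l) * condWeight b m l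
      ≤ (m : ℝ) ^ l * n.choose (m - l) * (cutWeight b m * y ^ l) := by
        have := (condWeight_pos b m l).le
        have := (cutWeight_pos b m).le
        gcongr
        exact h4.trans (by gcongr)
    _ = n.choose (m - l) * (n - m : ℝ) ^ l * cutWeight b m * (m * y / (n - m)) ^ l := by
        rw [div_pow, mul_pow]
        field_simp
    _ ≤ n.choose m * m ^ l * cutWeight b m * (m * y / (n - m)) ^ l := by
        have := (cutWeight_pos b m).le
        gcongr
    _ = expectedCuts b n m * (m ^ 2 * y / (n - m)) ^ l := by
        rw [expectedCuts, show (m : ℝ) ^ 2 * y / (n - m) = m * (m * y / (n - m)) by ring,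
          mul_pow (m : ℝ) (m * y / (n - m))]
        ring
    _ ≤ _ := by
        have := expectedCuts_nonneg b n m
        gcongr
        exact (div_le_iff₀ hnm').2 hx

theorem overlap_term_le_of_large (b : Bool) {n m l : ℕ} {x y : ℝ} (hy : 0 < y)
    (hy4 : y ^ 4 = 2 ^ m) (hlm : m ≤ 2 * l) (hl : l ≤ m)
    (hx : 4 * (m : ℝ) * n ≤ x * y ^ 3) :
    (m.choose l : ℝ) * n.choose (m - l) * condWeight b m l ≤ x ^ (m - l) := by
  obtain ⟨j, rfl⟩ := Nat.exists_eq_add_of_le hl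
  rw [condWeight, Nat.add_sub_cancel_left]
  have h1 : ((l + j).choose l : ℝ) ≤ ((l + j : ℕ) : ℝ) ^ j := by
    rw [Nat.choose_symm_add]
    exact_mod_cast Nat.choose_le_pow (l + j) j
  have h2 : (n.choose j : ℝ) ≤ (n : ℝ) ^ j := by exact_mod_cast Nat.choose_le_pow n j
  have h3 : (2 : ℝ) ^ (b.toNat * j) ≤ 2 ^ j :=
    pow_le_pow_right₀ (by norm_num) (by have := b.toNat_le; nlinarith)
  have h4 : (y ^ 3) ^ j ≤ 2 ^ j * 2 ^ ((l + j).choose 2 - l.choose 2) := by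
    refine (pow_le_pow_iff_left₀ (by positivity) (by positivity) (by norm_num : 4 ≠ 0)).1 ?_
    rw [← pow_add, ← pow_mul, ← pow_mul, ← pow_mul, show 3 * (j * 4) = 4 * (3 * j) by ring,
      pow_mul y 4, hy4, ← pow_mul]
    refine pow_le_pow_right₀ (by norm_num) ?_
    have e1 := two_mul_choose_two_add l
    have e2 := two_mul_choose_two_add (l + j)
    have e3 : l.choose 2 ≤ (l + j).choose 2 := Nat.choose_le_choose 2 (by omega)
    have hjl : j ≤ l := by omega
    zify [e3] at *
    nlinarith
  calc _ ≤ ((l + j : ℕ) : ℝ) ^ j * (n : ℝ) ^ j * (2 ^ j / 2 ^ ((l + j).choose 2 - l.choose 2)) := by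
        gcongr
    _ ≤ ((l + j : ℕ) : ℝ) ^ j * (n : ℝ) ^ j * (2 ^ j * 2 ^ j / (y ^ 3) ^ j) := by
        gcongr _ * ?_
        rw [div_le_div_iff₀ (by positivity) (by positivity)]
        calc _ ≤ (2 : ℝ) ^ j * (2 ^ j * 2 ^ ((l + j).choose 2 - l.choose 2)) := by gcongr
          _ = _ := by ring
    _ = (4 * ((l + j : ℕ) : ℝ) * n / y ^ 3) ^ j := by
        rw [div_pow, mul_pow, mul_pow, show (4 : ℝ) = 2 * 2 by norm_num, mul_pow]
        ring
    _ ≤ _ := by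
        gcongr
        exact (div_le_iff₀ (by positivity)).2 hx

theorem overlapSum_le (b : Bool) {n m : ℕ} {x y : ℝ} (hy : 0 < y) (hy4 : y ^ 4 = 2 ^ m)
    (hnm : m < n) (hx1 : x ≤ 1) (hxs : (m : ℝ) ^ 2 * y ≤ x * (n - m))
    (hxl : 4 * (m : ℝ) * n ≤ x * y ^ 3) :
    overlapSum b n m ≤ m * x * (expectedCuts b n m + 1) := by
  have hx0 : 0 ≤ x := by
    have : 0 ≤ x * y ^ 3 := le_trans (by positivity) hxl
    exact nonneg_of_mul_nonneg_left this (by positivity)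
  have hΛ := expectedCuts_nonneg b n m
  have hpow : ∀ {i : ℕ}, 1 ≤ i → x ^ i ≤ x := fun hi => pow_le_of_le_one hx0 hx1 (by omega)
  calc overlapSum b n m ≤ ∑ l ∈ Finset.Ico 2 m, x * (expectedCuts b n m + 1) := by
        refine Finset.sum_le_sum fun l hl => ?_
        rw [Finset.mem_Ico] at hl
        rcases le_total (2 * l) m with h | h
        · refine (overlap_term_le_of_small b hy hy4 h hnm hxs).trans ?_
          have := mul_le_mul_of_nonneg_left (hpow (by omega : 1 ≤ l)) hΛ
          linarith
        · refine (overlap_term_le_of_large b hy hy4 h hl.2.le hxl).trans ?_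
          have := hpow (by omega : 1 ≤ m - l)
          have := mul_nonneg hx0 hΛ
          linarith
    _ = ((m - 2 : ℕ) : ℝ) * (x * (expectedCuts b n m + 1)) := by
        rw [Finset.sum_const, Nat.card_Ico, nsmul_eq_mul]
    _ ≤ m * (x * (expectedCuts b n m + 1)) := by
        gcongr
        omega
    _ = _ := by ring

end Overlap

/-! ### Joint Poisson approximation for independent sets and bipartite graphs -/

section Joint

/-- No `m`-set of vertices carries the event `cutEvent b`. -/
def noCut (b : Bool) (n m : ℕ) : Set (Sym2 (Fin n) → Bool) :=
  noneOf (cutEvent b) (Finset.powersetCard m (Finset.univ : Finset (Fin n)))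

/-- The product formula approximating the probability of `noCut b n m`. -/
noncomputable def noCutApprox (b : Bool) (n m : ℕ) : ℝ :=
  ∏ T ∈ Finset.powersetCard m (Finset.univ : Finset (Fin n)),
    (1 - (erdosRenyi n (1 / 2)).real (cutEvent b T))

/-- The error in the joint Poisson approximation for independent `k`-sets and induced complete
bipartite graphs on `m` vertices. -/
noncomputable def jointError (n k m : ℕ) : ℝ :=
  3 * expectedCuts false n k * overlapSum false n k
    + 2 * (3 * expectedCuts false n k * overlapSum true n m)
    + 3 * expectedCuts true n m * overlapSum true n m

theorem dependence_union_le {n k m : ℕ} (hkm : k < m)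
    {D : Finset (Fin n) → Set (Sym2 (Fin n) → Bool)}
    (hDk : ∀ T ∈ Finset.powersetCard k Finset.univ, D T = cutEvent false T)
    (hDm : ∀ T ∈ Finset.powersetCard m Finset.univ, D T = cutEvent true T) :
    dependence D edgesIn (Finset.powersetCard k Finset.univ ∪ Finset.powersetCard m Finset.univ)
      ≤ jointError n k m := by
  have hdisj : Disjoint (Finset.powersetCard k (Finset.univ : Finset (Fin n)))
      (Finset.powersetCard m Finset.univ) := Finset.pairwise_disjoint_powersetCard _ hkm.ne
  have hkk := sum_dependent_pairs_le (n := n) (b := false) (b' := false) id (le_refl k)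
  have hkm' := sum_dependent_pairs_le (n := n) (b := false) (b' := true) (fun _ => rfl) hkm.le
  have hmm := sum_dependent_pairs_le (n := n) (b := true) (b' := true) id (le_refl m)
  set P := fun S => (erdosRenyi n (1 / 2)).real S
  have hsplit : dependence D edgesIn
      (Finset.powersetCard k Finset.univ ∪ Finset.powersetCard m Finset.univ)
      = ∑ T ∈ Finset.powersetCard k Finset.univ,
          ∑ T' ∈ Finset.powersetCard k Finset.univ with
            T' ≠ T ∧ ¬ Disjoint (edgesIn T) (edgesIn T'),
            (P (cutEvent false T) * P (cutEvent false T')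
              + P (cutEvent false T ∩ cutEvent false T'))
        + 2 * ∑ T ∈ Finset.powersetCard k Finset.univ,
          ∑ T' ∈ Finset.powersetCard m Finset.univ with
            T' ≠ T ∧ ¬ Disjoint (edgesIn T) (edgesIn T'),
            (P (cutEvent false T) * P (cutEvent true T') + P (cutEvent false T ∩ cutEvent true T'))
        + ∑ T ∈ Finset.powersetCard m Finset.univ,
          ∑ T' ∈ Finset.powersetCard m Finset.univ with
            T' ≠ T ∧ ¬ Disjoint (edgesIn T) (edgesIn T'),
            (P (cutEvent true T) * P (cutEvent true T')
              + P (cutEvent true T ∩ cutEvent true T')) := by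
    have hsymm : ∑ T ∈ Finset.powersetCard m Finset.univ,
          ∑ T' ∈ Finset.powersetCard k Finset.univ with
            T' ≠ T ∧ ¬ Disjoint (edgesIn T) (edgesIn T'),
            (P (cutEvent true T) * P (cutEvent false T') + P (cutEvent true T ∩ cutEvent false T'))
        = ∑ T ∈ Finset.powersetCard k Finset.univ,
          ∑ T' ∈ Finset.powersetCard m Finset.univ with
            T' ≠ T ∧ ¬ Disjoint (edgesIn T) (edgesIn T'),
            (P (cutEvent false T) * P (cutEvent true T')
              + P (cutEvent false T ∩ cutEvent true T')) := by
      simp only [Finset.sum_filter]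
      rw [Finset.sum_comm]
      refine Finset.sum_congr rfl fun T _ => Finset.sum_congr rfl fun T' _ => ?_
      simp only [ne_comm (a := T), disjoint_comm (a := edgesIn T'), mul_comm (P (cutEvent true T')),
        Set.inter_comm (cutEvent true T')]
    rw [dependence, Finset.sum_union hdisj]
    simp only [Finset.filter_union, Finset.sum_union (Finset.disjoint_filter_filter hdisj),
      Finset.sum_add_distrib (s := Finset.powersetCard _ _)]
    rw [two_mul]
    nth_rewrite 2 [← hsymm]
    have hcongr : ∀ {b b' : Bool} {i j : ℕ},
        (∀ T ∈ Finset.powersetCard i Finset.univ, D T = cutEvent b T) →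
        (∀ T ∈ Finset.powersetCard j Finset.univ, D T = cutEvent b' T) →
        ∑ T ∈ Finset.powersetCard i Finset.univ,
          ∑ T' ∈ Finset.powersetCard j Finset.univ with
            T' ≠ T ∧ ¬ Disjoint (edgesIn T) (edgesIn T'),
            (P (D T) * P (D T') + P (D T ∩ D T'))
        = ∑ T ∈ Finset.powersetCard i Finset.univ,
          ∑ T' ∈ Finset.powersetCard j Finset.univ with
            T' ≠ T ∧ ¬ Disjoint (edgesIn T) (edgesIn T'),
            (P (cutEvent b T) * P (cutEvent b' T') + P (cutEvent b T ∩ cutEvent b' T')) := by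
      intro b b' i j hi hj
      refine Finset.sum_congr rfl fun T hT => Finset.sum_congr rfl fun T' hT' => ?_
      rw [hi T hT, hj T' (Finset.mem_filter.1 hT').1]
    rw [← hcongr hDk hDk, ← hcongr hDk hDm, ← hcongr hDm hDk, ← hcongr hDm hDm]
    ring
  rw [hsplit, jointError]
  linarith

theorem abs_real_noCut_sub_le {n k m : ℕ} (hkm : k < m) :
    |(erdosRenyi n (1 / 2)).real (noCut false n k) - noCutApprox false n k| ≤ jointError n k m ∧
    |(erdosRenyi n (1 / 2)).real (noCut true n m) - noCutApprox true n m| ≤ jointError n k m ∧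
    |(erdosRenyi n (1 / 2)).real (noCut false n k ∩ noCut true n m)
      - noCutApprox false n k * noCutApprox true n m| ≤ jointError n k m := by
  set D : Finset (Fin n) → Set (Sym2 (Fin n) → Bool) := fun T => cutEvent (decide (T.card = m)) T
  have hDk : ∀ T ∈ Finset.powersetCard k Finset.univ, D T = cutEvent false T := fun T hT => by
    have : T.card ≠ m := by rw [(Finset.mem_powersetCard.1 hT).2]; exact hkm.ne
    simp [D, this]
  have hDm : ∀ T ∈ Finset.powersetCard m Finset.univ, D T = cutEvent true T := fun T hT => by
    simp [D, (Finset.mem_powersetCard.1 hT).2]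
  have hdisj : Disjoint (Finset.powersetCard k (Finset.univ : Finset (Fin n)))
      (Finset.powersetCard m Finset.univ) := Finset.pairwise_disjoint_powersetCard _ hkm.ne
  have hdep := dependence_union_le hkm hDk hDm
  have hdet : ∀ T, DeterminedBy (D T) (edgesIn T : Set (Sym2 (Fin n))) := fun T =>
    determinedBy_cutEvent _ T
  have key := fun 𝓖 (h : 𝓖 ⊆ _) => (abs_real_noneOf_sub_prod_le D edgesIn 𝓖 fun T _ => hdet T).trans
    ((dependence_mono D edgesIn h).trans hdep)
  have hnk : noneOf D (Finset.powersetCard k Finset.univ) = noCut false n k :=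
    Set.ext fun ω => forall₂_congr fun T hT => by rw [hDk T hT]
  have hnm : noneOf D (Finset.powersetCard m Finset.univ) = noCut true n m :=
    Set.ext fun ω => forall₂_congr fun T hT => by rw [hDm T hT]
  have hpk : ∏ T ∈ Finset.powersetCard k Finset.univ, (1 - (erdosRenyi n (1 / 2)).real (D T))
      = noCutApprox false n k := Finset.prod_congr rfl fun T hT => by rw [hDk T hT]
  have hpm : ∏ T ∈ Finset.powersetCard m Finset.univ, (1 - (erdosRenyi n (1 / 2)).real (D T))
      = noCutApprox true n m := Finset.prod_congr rfl fun T hT => by rw [hDm T hT]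
  refine ⟨?_, ?_, ?_⟩
  · rw [← hnk, ← hpk]
    exact key _ Finset.subset_union_left
  · rw [← hnm, ← hpm]
    exact key _ Finset.subset_union_right
  · have h := key _ (Finset.Subset.refl _)
    rw [Finset.prod_union hdisj, hpk, hpm] at h
    rwa [← hnk, ← hnm, show noneOf D (Finset.powersetCard k Finset.univ)
      ∩ noneOf D (Finset.powersetCard m Finset.univ)
      = noneOf D (Finset.powersetCard k Finset.univ ∪ Finset.powersetCard m Finset.univ) from
        Set.ext fun ω => by simp only [noneOf, Finset.forall_mem_union]; rfl]

theorem noCutApprox_le (b : Bool) (n : ℕ) {m : ℕ} (hm : 2 ≤ m) :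
    noCutApprox b n m ≤ exp (-(expectedCuts b n m / 4)) := by
  calc noCutApprox b n m
      ≤ ∏ T ∈ Finset.powersetCard m (Finset.univ : Finset (Fin n)),
        exp (-(erdosRenyi n (1 / 2)).real (cutEvent b T)) := by
        refine Finset.prod_le_prod (fun T _ => sub_nonneg.2 measureReal_le_one) fun T _ => ?_
        exact one_sub_le_exp_neg _
    _ = exp (-∑ T ∈ Finset.powersetCard m (Finset.univ : Finset (Fin n)),
        (erdosRenyi n (1 / 2)).real (cutEvent b T)) := by
        rw [← exp_sum, Finset.sum_neg_distrib]
    _ ≤ _ := by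
        gcongr
        exact expectedCuts_le_sum_real_cutEvent b n hm

theorem le_noCutApprox (b : Bool) (n : ℕ) {m : ℕ} (hm : cutWeight b m ≤ 1 / 2) :
    exp (-(2 * expectedCuts b n m)) ≤ noCutApprox b n m := by
  calc exp (-(2 * expectedCuts b n m))
      ≤ exp (-(2 * ∑ T ∈ Finset.powersetCard m (Finset.univ : Finset (Fin n)),
        (erdosRenyi n (1 / 2)).real (cutEvent b T))) := by
        gcongr
        exact sum_real_cutEvent_le b n m
    _ = ∏ T ∈ Finset.powersetCard m (Finset.univ : Finset (Fin n)),
        exp (-(2 * (erdosRenyi n (1 / 2)).real (cutEvent b T))) := by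
        rw [← exp_sum, Finset.sum_neg_distrib, Finset.mul_sum]
    _ ≤ _ := by
        refine Finset.prod_le_prod (fun T _ => (exp_pos _).le) fun T hT => ?_
        have h1 : (erdosRenyi n (1 / 2)).real (cutEvent b T) ≤ 1 / 2 := by
          refine (real_cutEvent_le b T).trans ?_
          rwa [(Finset.mem_powersetCard.1 hT).2]
        have h0 : 0 ≤ (erdosRenyi n (1 / 2)).real (cutEvent b T) := measureReal_nonneg
        set p := (erdosRenyi n (1 / 2)).real (cutEvent b T)
        rw [exp_neg, inv_le_iff_one_le_mul₀ (exp_pos _)]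
        have h2 := add_one_le_exp (2 * p)
        nlinarith

/-- If the expected numbers are of constant order and the error terms small, then each of the four
combinations of presence and absence has probability bounded below. -/
theorem le_real_noCut_patterns {n k m : ℕ} {δ : ℝ} (hkm : k < m) (hδ : 0 ≤ δ)
    (hk : δ ≤ noCutApprox false n k) (hk' : noCutApprox false n k ≤ 1 - δ)
    (hm : δ ≤ noCutApprox true n m) (hm' : noCutApprox true n m ≤ 1 - δ) :
    δ ^ 2 - 3 * jointError n k m
        ≤ (erdosRenyi n (1 / 2)).real (noCut false n k ∩ noCut true n m) ∧
    δ ^ 2 - 3 * jointError n k m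
        ≤ (erdosRenyi n (1 / 2)).real (noCut false n k \ noCut true n m) ∧
    δ ^ 2 - 3 * jointError n k m
        ≤ (erdosRenyi n (1 / 2)).real (noCut true n m \ noCut false n k) ∧
    δ ^ 2 - 3 * jointError n k m
        ≤ (erdosRenyi n (1 / 2)).real (noCut false n k ∪ noCut true n m)ᶜ := by
  obtain ⟨h1, h2, h3⟩ := abs_real_noCut_sub_le (n := n) hkm
  rw [abs_le] at h1 h2 h3
  have e1 := measureReal_sdiff_add_inter (μ := erdosRenyi n (1 / 2)) (s := noCut false n k)
    (measurableSet_coins (noCut true n m))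
  have e2 := measureReal_sdiff_add_inter (μ := erdosRenyi n (1 / 2)) (s := noCut true n m)
    (measurableSet_coins (noCut false n k))
  have e3 := probReal_compl_eq_one_sub (μ := erdosRenyi n (1 / 2))
    (measurableSet_coins (noCut false n k ∪ noCut true n m))
  have e4 := measureReal_union_add_inter (μ := erdosRenyi n (1 / 2)) (s := noCut false n k)
    (measurableSet_coins (noCut true n m))
  rw [Set.inter_comm (noCut true n m)] at e2
  set a := noCutApprox false n k
  set b := noCutApprox true n m
  have f1 : δ * δ ≤ a * b := mul_le_mul hk hm hδ (hδ.trans hk)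
  have f2 : δ * δ ≤ a * (1 - b) := mul_le_mul hk (by linarith) hδ (hδ.trans hk)
  have f3 : δ * δ ≤ b * (1 - a) := mul_le_mul hm (by linarith) hδ (hδ.trans hm)
  have f4 : δ * δ ≤ (1 - a) * (1 - b) :=
    mul_le_mul (by linarith) (by linarith) hδ (by linarith)
  refine ⟨?_, ?_, ?_, ?_⟩ <;> nlinarith

end Joint

/-! ### The values of `alpha` and `beta` -/

section Deterministic

variable {n : ℕ} {ω : Sym2 (Fin n) → Bool}

theorem notMem_noCut {b : Bool} {m : ℕ} :
    ω ∉ noCut b n m ↔ ∃ T : Finset (Fin n), T.card = m ∧ ω ∈ cutEvent b T := by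
  simp only [noCut, noneOf, Set.mem_ofPred_eq, not_forall, not_not, Finset.mem_powersetCard,
    Finset.subset_univ, true_and, exists_prop]

theorem isIndepFinset_mono {V : Type*} {G : SimpleGraph V} {S T : Finset V} (h : T ⊆ S)
    (hS : IsIndepFinset G S) : IsIndepFinset G T :=
  fun a ha b hb => hS a (h ha) b (h hb)

theorem exists_subset_isInducedCompleteBipartite {V : Type*} [DecidableEq V] {G : SimpleGraph V}
    {S A B : Finset V} (h : IsInducedCompleteBipartite G S A B) {m : ℕ} (hm : 2 ≤ m)
    (hmS : m ≤ S.card) :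
    ∃ T A' B' : Finset V, T.card = m ∧ IsInducedCompleteBipartite G T A' B' := by
  obtain ⟨⟨a, ha⟩, ⟨b, hb⟩, hAB, hU, hadj⟩ := h
  have hU' : A ∪ B = S := Finset.coe_injective (by rw [Finset.coe_union, hU])
  have haS : a ∈ S := hU' ▸ Finset.mem_union_left _ ha
  have hbS : b ∈ S := hU' ▸ Finset.mem_union_right _ hb
  obtain ⟨T, hT, hTS, hTm⟩ := Finset.exists_subsuperset_card_eq
    (s := {a, b}) (t := S) (n := m) (by simp [Finset.insert_subset_iff, haS, hbS])
    (Finset.card_le_two.trans hm) hmS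
  have haT : a ∈ T := hT (by simp)
  have hbT : b ∈ T := hT (by simp)
  refine ⟨T, T ∩ A, T ∩ B, hTm, ⟨a, Finset.mem_inter.2 ⟨haT, ha⟩⟩,
    ⟨b, Finset.mem_inter.2 ⟨hbT, hb⟩⟩,
    hAB.mono Finset.inter_subset_right Finset.inter_subset_right, ?_, fun u hu v hv => ?_⟩
  · rw [← Finset.coe_union, ← Finset.inter_union_distrib_left, hU',
      Finset.inter_eq_left.2 hTS]
  · rw [hadj u (hTS hu) v (hTS hv)]
    simp only [Finset.mem_inter, hu, hv, true_and]

theorem alpha_eq {m : ℕ} (hm : ω ∉ noCut false n m) (hm' : ω ∈ noCut false n (m + 1)) :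
    alpha (graphOf n ω) = m := by
  obtain ⟨T, hTm, hT⟩ := notMem_noCut.1 hm
  refine IsGreatest.csSup_eq ⟨⟨T, hTm, mem_cutEvent_false.1 hT⟩, ?_⟩
  rintro M ⟨S, rfl, hS⟩
  by_contra! hlt
  obtain ⟨T', hT'S, hT'm⟩ := Finset.exists_subset_card_eq hlt
  exact notMem_noCut.2 ⟨T', hT'm, mem_cutEvent_false.2 (isIndepFinset_mono hT'S hS)⟩ hm'

theorem beta_eq {m : ℕ} (h1m : 1 ≤ m) (hm : ω ∉ noCut true n m) (hm' : ω ∈ noCut true n (m + 1)) :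
    beta (graphOf n ω) = m := by
  obtain ⟨T, hTm, hT⟩ := notMem_noCut.1 hm
  obtain ⟨A, B, hAB⟩ := mem_cutEvent_true.1 hT
  refine IsGreatest.csSup_eq ⟨⟨T, A, B, hAB, hTm⟩, ?_⟩
  rintro M ⟨S, A', B', hS, rfl⟩
  by_contra! hlt
  obtain ⟨T', A'', B'', hT'm, hT'⟩ :=
    exists_subset_isInducedCompleteBipartite hS (m := m + 1) (by omega) hlt
  exact notMem_noCut.2 ⟨T', hT'm, mem_cutEvent_true.2 ⟨A'', B'', hT'⟩⟩ hm'

/-- The coin flips for which `alpha` is `k - 1` or `k` and `beta` is `k + 1` or `k + 2`. -/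
def typicalCoins (n k : ℕ) : Set (Sym2 (Fin n) → Bool) :=
  {ω | ω ∉ noCut false n (k - 1) ∧ ω ∈ noCut false n (k + 1) ∧
    ω ∉ noCut true n (k + 1) ∧ ω ∈ noCut true n (k + 3)}

theorem alpha_of_mem_typicalCoins {k : ℕ} (hk : 1 ≤ k) (h : ω ∈ typicalCoins n k) :
    (ω ∈ noCut false n k → alpha (graphOf n ω) = k - 1) ∧
    (ω ∉ noCut false n k → alpha (graphOf n ω) = k) :=
  ⟨fun h' => alpha_eq h.1 (by rwa [Nat.sub_add_cancel hk]), fun h' => alpha_eq h' h.2.1⟩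

theorem beta_of_mem_typicalCoins {k : ℕ} (h : ω ∈ typicalCoins n k) :
    (ω ∈ noCut true n (k + 2) → beta (graphOf n ω) = k + 1) ∧
    (ω ∉ noCut true n (k + 2) → beta (graphOf n ω) = k + 2) :=
  ⟨fun h' => beta_eq (by omega) h.2.2.1 h', fun h' => beta_eq (by omega) h' h.2.2.2⟩

theorem real_compl_typicalCoins_le (n k : ℕ) :
    (erdosRenyi n (1 / 2)).real (typicalCoins n k)ᶜ
      ≤ (erdosRenyi n (1 / 2)).real (noCut false n (k - 1)) + expectedCuts false n (k + 1)
        + ((erdosRenyi n (1 / 2)).real (noCut true n (k + 1)) + expectedCuts true n (k + 3)) := by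
  have hcompl : ∀ b m, (erdosRenyi n (1 / 2)).real (noCut b n m)ᶜ ≤ expectedCuts b n m := by
    intro b m
    have hsub : (noCut b n m)ᶜ ⊆
        ⋃ T ∈ Finset.powersetCard m (Finset.univ : Finset (Fin n)), cutEvent b T := by
      intro ω hω
      obtain ⟨T, hTm, hT⟩ := notMem_noCut.1 hω
      exact Set.mem_biUnion (Finset.mem_coe.2
        (Finset.mem_powersetCard.2 ⟨Finset.subset_univ T, hTm⟩)) hT
    exact (measureReal_mono hsub (measure_ne_top _ _)).trans
      ((measureReal_biUnion_finset_le _ _).trans (sum_real_cutEvent_le b n m))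
  have hsub : (typicalCoins n k)ᶜ ⊆ (noCut false n (k - 1) ∪ (noCut false n (k + 1))ᶜ)
      ∪ (noCut true n (k + 1) ∪ (noCut true n (k + 3))ᶜ) := by
    intro ω hω
    simp only [typicalCoins, Set.mem_compl_iff, Set.mem_ofPred_eq, Set.mem_union] at hω ⊢
    tauto
  refine (measureReal_mono hsub).trans ((measureReal_union_le _ _).trans (add_le_add
    ((measureReal_union_le _ _).trans ?_) ((measureReal_union_le _ _).trans ?_)))
  · gcongr
    exact hcompl _ _
  · gcongr
    exact hcompl _ _

end Deterministic

/-! ### The order of magnitude of `k` and of the expected numbers -/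

section Magnitude

variable {n k : ℕ} {c v : ℝ}

theorem le_of_one_le_expectedCuts (b : Bool) (h : 0 < expectedCuts b n k) : k ≤ n := by
  by_contra! hlt
  rw [expectedCuts, Nat.choose_eq_zero_of_lt hlt, Nat.cast_zero, zero_mul] at h
  exact h.false

theorem size_bounds {w : ℝ} (hw : 0 < w) (hwk : w ^ 2 = 2 ^ k) (hk : 1 ≤ k)
    (h1 : 1 ≤ expectedCuts false n k) (hc : expectedCuts false n k ≤ c) :
    (n : ℝ) ≤ 2 * c * k * w ∧ w * k ≤ 4 * n := by
  have hc1 : 1 ≤ c := h1.trans hc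
  have hkn := le_of_one_le_expectedCuts false (zero_lt_one.trans_le h1)
  have hk0 : (0 : ℝ) < k := by exact_mod_cast hk
  have hfac : (0 : ℝ) < k.factorial := by exact_mod_cast k.factorial_pos
  have hw1 : 1 ≤ w := by
    rw [← one_le_sq_iff₀ hw.le, hwk]
    exact one_le_pow₀ (by norm_num)
  set t : ℝ := 2 ^ (k.choose 2) with ht
  have ht0 : 0 < t := by positivity
  have ht2 : t ^ 2 * 2 ^ k = (w ^ k) ^ 2 := by
    rw [ht, ← pow_mul w, mul_comm k 2, pow_mul w, hwk, ← pow_mul, ← pow_mul, ← pow_add,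
      mul_comm _ 2, two_mul_choose_two_add]
  have htw : t ≤ w ^ k := by
    refine (pow_le_pow_iff_left₀ ht0.le (by positivity) two_ne_zero).1 ?_
    rw [← ht2]
    exact le_mul_of_one_le_right (by positivity) (one_le_pow₀ (by norm_num))
  have hF : expectedCuts false n k = n.choose k / t := by
    simp [expectedCuts, cutWeight, ht, div_eq_mul_inv]
  rw [hF] at h1 hc
  rw [one_le_div ht0] at h1
  rw [div_le_iff₀ ht0] at hc
  constructor
  · have h2 : ((n + 1 - k : ℕ) : ℝ) ^ k ≤ (c * k * w) ^ k := by
      have h3 := Nat.pow_le_choose (α := ℝ) k n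
      rw [div_le_iff₀ hfac] at h3
      calc ((n + 1 - k : ℕ) : ℝ) ^ k ≤ n.choose k * k.factorial := h3
        _ ≤ c * w ^ k * k ^ k := by
          have : (k.factorial : ℝ) ≤ (k : ℝ) ^ k := by exact_mod_cast k.factorial_le_pow
          have hc' : (n.choose k : ℝ) ≤ c * w ^ k := hc.trans (by gcongr)
          gcongr
        _ ≤ c ^ k * w ^ k * k ^ k := by
          gcongr
          exact le_self_pow₀ hc1 (by omega)
        _ = _ := by rw [mul_pow, mul_pow]; ring
    have h4 := (pow_le_pow_iff_left₀ (by positivity) (by positivity) (by omega)).1 h2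
    rw [Nat.cast_sub (by omega), Nat.cast_add, Nat.cast_one] at h4
    have h5 : (k : ℝ) ≤ c * k * w := by
      have h6 : 1 ≤ c * w := one_le_mul_of_one_le_of_one_le hc1 hw1
      nlinarith
    linarith
  · have h2 : (w * k) ^ k ≤ (4 * n : ℝ) ^ k := by
      refine (pow_le_pow_iff_left₀ (by positivity) (by positivity) two_ne_zero).1 ?_
      have h3 : (k : ℝ) ^ k ≤ exp 1 ^ k * k.factorial := by
        have := pow_div_factorial_le_exp (k : ℝ) hk0.le k
        rw [div_le_iff₀ hfac] at this
        rwa [← exp_nat_mul, mul_one]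
      have h4 : t * k ^ k ≤ (n : ℝ) ^ k * exp 1 ^ k := by
        have h5 := Nat.choose_le_pow_div (α := ℝ) k n
        rw [le_div_iff₀ hfac] at h5
        calc t * (k : ℝ) ^ k ≤ n.choose k * (exp 1 ^ k * k.factorial) := by gcongr
          _ = n.choose k * k.factorial * exp 1 ^ k := by ring
          _ ≤ _ := by gcongr
      calc ((w * k) ^ k) ^ 2 = (w ^ k) ^ 2 * ((k : ℝ) ^ k) ^ 2 := by rw [mul_pow, mul_pow]
        _ = (t * (k : ℝ) ^ k) ^ 2 * 2 ^ k := by rw [← ht2]; ring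
        _ ≤ ((n : ℝ) ^ k * exp 1 ^ k) ^ 2 * 2 ^ k := by gcongr
        _ = (n ^ 2 * (2 * exp 1 ^ 2)) ^ k := by
          rw [mul_pow, mul_pow, mul_pow, ← pow_mul, ← pow_mul, ← pow_mul, ← pow_mul, mul_comm k 2]
          ring
        _ ≤ (n ^ 2 * 16) ^ k := by
          have := exp_one_lt_d9
          have := exp_pos 1
          gcongr
          nlinarith
        _ = ((4 * n : ℝ) ^ k) ^ 2 := by
          rw [← pow_mul, mul_comm k 2, pow_mul]
          ring
    exact (pow_le_pow_iff_left₀ (by positivity) (by positivity) (by omega)).1 h2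

theorem expectedCuts_succ (b : Bool) {n m : ℕ} (hm : m ≤ n) :
    (m + 1 : ℝ) * 2 ^ m * expectedCuts b n (m + 1)
      = expectedCuts b n m * (n - m) * 2 ^ b.toNat := by
  have h1 : (n.choose (m + 1) : ℝ) * (m + 1) = n.choose m * (n - m) := by
    rw [← Nat.cast_sub hm]
    exact_mod_cast Nat.choose_succ_right_eq n m
  have h2 : (m + 1).choose 2 = m.choose 2 + m := by
    rw [Nat.choose_succ_succ' m 1, Nat.choose_one_right, add_comm]
  rw [expectedCuts, expectedCuts, cutWeight, cutWeight, h2, mul_add, mul_one, pow_add, pow_add]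
  have : (n.choose (m + 1) : ℝ) = n.choose m * (n - m) / (m + 1) := by
    rw [← h1]; field_simp
  rw [this]
  field_simp

theorem expectedCuts_true (n m : ℕ) : expectedCuts true n m = 2 ^ m * expectedCuts false n m := by
  simp [expectedCuts, cutWeight]
  ring

theorem expectedCuts_succ_bounds (b : Bool) {m : ℕ} (hk : 1 ≤ k) (hv : 0 < v)
    (hvk : v ^ 4 = 2 ^ k) (hup : (n : ℝ) ≤ c * k * v ^ 2) (hlow : v ^ 2 * k ≤ 4 * n)
    (hmk : m ≤ k + 2) (hkm : k ≤ m + 1) (hmn : 2 * m ≤ n) :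
    expectedCuts b n m ≤ 128 * v ^ 2 * expectedCuts b n (m + 1) ∧
      v ^ 2 * expectedCuts b n (m + 1) ≤ 4 * c * expectedCuts b n m := by
  have hrec := expectedCuts_succ b (n := n) (m := m) (by omega)
  have hk0 : (1 : ℝ) ≤ k := by exact_mod_cast hk
  have h0 := expectedCuts_nonneg b n m
  have h1 := expectedCuts_nonneg b n (m + 1)
  have hm1 : (m + 1 : ℝ) ≤ 4 * k := by
    have : (m : ℝ) ≤ k + 2 := by exact_mod_cast hmk
    linarith
  have hm2 : (k : ℝ) ≤ m + 1 := by exact_mod_cast hkm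
  have hp1 : (2 : ℝ) ^ m ≤ 4 * v ^ 4 := by
    rw [hvk]
    calc (2 : ℝ) ^ m ≤ 2 ^ (k + 2) := pow_le_pow_right₀ (by norm_num) hmk
      _ = _ := by ring
  have hp2 : v ^ 4 ≤ 2 * 2 ^ m := by
    rw [hvk, ← pow_succ']
    exact pow_le_pow_right₀ (by norm_num) hkm
  have hb1 : (1 : ℝ) ≤ 2 ^ b.toNat := one_le_pow₀ (by norm_num)
  have hb2 : (2 : ℝ) ^ b.toNat ≤ 2 := by cases b <;> norm_num
  have hmn' : 2 * (m : ℝ) ≤ n := by exact_mod_cast hmn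
  have hm0 : (0 : ℝ) ≤ m := Nat.cast_nonneg m
  set Λ := expectedCuts b n m
  set Λ' := expectedCuts b n (m + 1)
  constructor
  · refine le_of_mul_le_mul_left ?_ (show 0 < v ^ 2 * k / 8 by positivity)
    calc v ^ 2 * k / 8 * Λ ≤ (n - m) * Λ := by gcongr; linarith
      _ = Λ * (n - m) * 1 := by ring
      _ ≤ Λ * (n - m) * 2 ^ b.toNat := by
        have : 0 ≤ (n - m : ℝ) := by linarith
        gcongr
      _ = (m + 1 : ℝ) * 2 ^ m * Λ' := hrec.symm
      _ ≤ 4 * k * (4 * v ^ 4) * Λ' := by gcongr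
      _ = _ := by ring
  · refine le_of_mul_le_mul_left ?_ (show 0 < v ^ 2 * k / 2 by positivity)
    calc v ^ 2 * k / 2 * (v ^ 2 * Λ') = k * (v ^ 4 / 2) * Λ' := by ring
      _ ≤ (m + 1) * 2 ^ m * Λ' := by gcongr; linarith
      _ = Λ * (n - m) * 2 ^ b.toNat := hrec
      _ ≤ Λ * n * 2 := by
        have : 0 ≤ (n - m : ℝ) := by linarith
        gcongr
        linarith
      _ ≤ Λ * (c * k * v ^ 2) * 2 := by gcongr
      _ = _ := by ring

theorem overlapSum_le_of_near (b : Bool) {m : ℕ} (hk : 1 ≤ k) (hv : 0 < v)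
    (hvk : v ^ 4 = 2 ^ k) (hc : 1 ≤ c) (hup : (n : ℝ) ≤ c * k * v ^ 2)
    (hlow : v ^ 2 * k ≤ 4 * n) (hsmall : 144 * c * k ^ 3 ≤ v)
    (hmk : m ≤ k + 2) (hkm : k ≤ m + 1) (hmn : 2 * m ≤ n) (hn : 0 < n) :
    overlapSum b n m ≤ 432 * c * (k ^ 3 / v) * (expectedCuts b n m + 1) := by
  have hk0 : (1 : ℝ) ≤ k := by exact_mod_cast hk
  have hm1 : (m : ℝ) ≤ 3 * k := by
    have : (m : ℝ) ≤ k + 2 := by exact_mod_cast hmk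
    linarith
  have hmn' : 2 * (m : ℝ) ≤ n := by exact_mod_cast hmn
  have hΛ := expectedCuts_nonneg b n m
  set y : ℝ := 2 ^ ((m : ℝ) / 4) with hy
  have hy0 : 0 < y := by positivity
  have hy4 : y ^ 4 = 2 ^ m := by
    rw [hy, ← rpow_natCast, ← rpow_mul (by norm_num), ← rpow_natCast 2 m]
    congr 1
    push_cast
    ring
  have hy2 : y ≤ 2 * v := by
    refine (pow_le_pow_iff_left₀ hy0.le (by positivity) (by norm_num : 4 ≠ 0)).1 ?_
    rw [hy4, mul_pow, hvk, ← pow_add]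
    exact pow_le_pow_right₀ (by norm_num) (by omega)
  have hvy : v ≤ 2 * y := by
    refine (pow_le_pow_iff_left₀ hv.le (by positivity) (by norm_num : 4 ≠ 0)).1 ?_
    rw [mul_pow, hvk, hy4, ← pow_add]
    exact pow_le_pow_right₀ (by norm_num) (by omega)
  have hk23 : (k : ℝ) ^ 2 ≤ k ^ 3 := pow_le_pow_right₀ hk0 (by norm_num)
  refine (overlapSum_le b hy0 hy4 (x := 144 * c * k ^ 2 / v) (by omega) ?_ ?_ ?_).trans ?_
  · rw [div_le_one hv]
    refine le_trans ?_ hsmall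
    gcongr
  · calc (m : ℝ) ^ 2 * y ≤ (3 * k) ^ 2 * (2 * v) := by gcongr
      _ = 144 * 1 * k ^ 1 / v * (v ^ 2 * k / 8) := by field_simp; ring
      _ ≤ 144 * c * k ^ 2 / v * (n - m) := by
        gcongr
        · norm_num
        · linarith
  · calc 4 * (m : ℝ) * n ≤ 4 * (3 * k) * (c * k * v ^ 2) := by gcongr
      _ = 96 * c * k ^ 2 / v * (v ^ 3 / 8) := by field_simp; ring
      _ ≤ 144 * c * k ^ 2 / v * y ^ 3 := by
        gcongr
        · norm_num
        · have : v ^ 3 ≤ (2 * y) ^ 3 := by gcongr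
          linarith
  · calc (m : ℝ) * (144 * c * k ^ 2 / v) * (expectedCuts b n m + 1)
        ≤ 3 * k * (144 * c * k ^ 2 / v) * (expectedCuts b n m + 1) := by gcongr
      _ = _ := by ring

end Magnitude

section Estimates

variable {n k : ℕ} {c v : ℝ}

theorem real_noCut_le (b : Bool) {m : ℕ} {ε : ℝ} (hm : 2 ≤ m) (hΛ : 0 < expectedCuts b n m)
    (h : overlapSum b n m ≤ ε * (expectedCuts b n m + 1)) :
    (erdosRenyi n (1 / 2)).real (noCut b n m)
      ≤ 16 * (1 + 3 * ε) / expectedCuts b n m + 48 * ε := by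
  have h1 := expectedCuts_mul_real_noneOf_le b n hm
  have h2 : 16 * (1 + 3 * ε) / expectedCuts b n m + 48 * ε
      = 16 * (1 + 3 * (ε * (expectedCuts b n m + 1))) / expectedCuts b n m := by
    field_simp
    ring
  rw [h2, le_div_iff₀ hΛ, mul_comm]
  exact h1.trans (by gcongr)

theorem typical_estimates (hk : 1 ≤ k) (hv : 0 < v) (hvk : v ^ 4 = 2 ^ k) (hc : 1 ≤ c)
    (h1 : 1 ≤ expectedCuts false n k) (hF : expectedCuts false n k ≤ c)
    (hup : (n : ℝ) ≤ c * k * v ^ 2) (hlow : v ^ 2 * k ≤ 4 * n) (hsmall : 144 * c * k ^ 3 ≤ v) :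
    2 ≤ k ∧ jointError n k (k + 2) ≤ 400000 * c ^ 7 * (k ^ 3 / v) ∧
    (erdosRenyi n (1 / 2)).real (typicalCoins n k)ᶜ ≤ 400000 * c ^ 7 * (k ^ 3 / v) ∧
    1 / 16384 ≤ expectedCuts true n (k + 2) ∧ expectedCuts true n (k + 2) ≤ 16 * c ^ 3 := by
  have hk0 : (1 : ℝ) ≤ k := by exact_mod_cast hk
  have hc0 : 0 < c := by linarith
  have hk3 : (1 : ℝ) ≤ k ^ 3 := one_le_pow₀ hk0
  have hck : 1 ≤ c * k ^ 3 := one_le_mul_of_one_le_of_one_le hc hk3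
  have hv1 : 144 ≤ v := by linarith
  have hk3' : 3 ≤ k := by
    by_contra! hlt
    have h2 : (2 : ℝ) ^ k ≤ 2 ^ 2 := pow_le_pow_right₀ (by norm_num) (by omega)
    have h3 : (144 : ℝ) ^ 4 ≤ v ^ 4 := by gcongr
    rw [hvk] at h3
    norm_num at h2 h3
    linarith
  have hnk : 2 * (k + 3) ≤ n := by
    have h2 : (144 : ℝ) ^ 2 ≤ v ^ 2 := by gcongr
    have h3 : (2 * (k + 3) : ℝ) ≤ n := by nlinarith
    exact_mod_cast h3
  set ρ : ℝ := k ^ 3 / v with hρ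
  have hρ0 : 0 < ρ := by positivity
  have hρ1 : 144 * c * ρ ≤ 1 := by
    rw [hρ, ← mul_div_assoc, div_le_one hv]
    exact hsmall
  have hvρ : 1 / v ^ 2 ≤ ρ := by
    rw [hρ, div_le_div_iff₀ (by positivity) hv, one_mul]
    nlinarith
  have hbd := fun b m => expectedCuts_succ_bounds b (m := m) (n := n) (c := c) hk hv hvk hup hlow
  have hR := fun b m (hm : m ≤ k + 2) (hm' : k ≤ m + 1) =>
    overlapSum_le_of_near b (m := m) (n := n) (c := c) hk hv hvk hc hup hlow hsmall
      hm hm' (by omega) (by omega)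
  have h0 := fun b m => expectedCuts_nonneg b n m
  have a1 := (hbd false (k - 1) (by omega) (by omega) (by omega)).2
  rw [Nat.sub_add_cancel hk] at a1
  have a2 := (hbd false k (by omega) (by omega) (by omega)).2
  have a3 := hbd true k (by omega) (by omega) (by omega)
  have a4 := hbd true (k + 1) (by omega) (by omega) (by omega)
  have a5 := (hbd true (k + 2) (by omega) (by omega) (by omega)).2
  have r1 := hR false (k - 1) (by omega) (by omega)
  have r2 := hR false k (by omega) (by omega)
  have r3 := hR true (k + 1) (by omega) (by omega)
  have r4 := hR true (k + 2) (by omega) (by omega)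
  simp only [add_assoc, Nat.reduceAdd] at a3 a4 a5
  rw [expectedCuts_true, ← hvk] at a3
  set F := expectedCuts false n k
  set Fm := expectedCuts false n (k - 1)
  set Fp := expectedCuts false n (k + 1)
  set H1 := expectedCuts true n (k + 1)
  set H2 := expectedCuts true n (k + 2)
  set H3 := expectedCuts true n (k + 3)
  have hv2 : 0 < v ^ 2 := by positivity
  have bFm : v ^ 2 / (4 * c) ≤ Fm := by
    rw [div_le_iff₀ (by positivity)]
    nlinarith
  have bFp : Fp ≤ 4 * c ^ 2 * (1 / v ^ 2) := by
    rw [← mul_div_assoc, mul_one, le_div_iff₀ hv2]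
    nlinarith
  have bH1 : v ^ 2 ≤ 128 * H1 := by
    refine le_of_mul_le_mul_left ?_ hv2
    have : v ^ 2 * v ^ 2 * 1 ≤ v ^ 4 * F := by rw [← pow_add]; gcongr
    linarith [a3.1]
  have bH1' : H1 ≤ 4 * c ^ 2 * v ^ 2 := by
    refine le_of_mul_le_mul_left ?_ hv2
    calc _ ≤ 4 * c * (v ^ 4 * F) := a3.2
      _ ≤ 4 * c * (v ^ 4 * c) := by gcongr
      _ = _ := by ring
  have bH2 : 1 / 16384 ≤ H2 := by
    refine le_of_mul_le_mul_left ?_ hv2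
    linarith [a4.1]
  have bH2' : H2 ≤ 16 * c ^ 3 := by
    refine le_of_mul_le_mul_left ?_ hv2
    calc _ ≤ 4 * c * H1 := a4.2
      _ ≤ 4 * c * (4 * c ^ 2 * v ^ 2) := by gcongr
      _ = _ := by ring
  have bH3 : H3 ≤ 64 * c ^ 4 * (1 / v ^ 2) := by
    rw [← mul_div_assoc, mul_one, le_div_iff₀ hv2]
    calc _ = v ^ 2 * H3 := mul_comm _ _
      _ ≤ 4 * c * H2 := a5
      _ ≤ 4 * c * (16 * c ^ 3) := by gcongr
      _ = _ := by ring
  have hcp : ∀ i j, i ≤ j → c ^ i ≤ c ^ j := fun i j h => pow_le_pow_right₀ hc h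
  refine ⟨by omega, ?_, ?_, bH2, bH2'⟩
  · have e1 : overlapSum false n k ≤ 432 * c * ρ * (2 * c) :=
      r2.trans (by gcongr; linarith)
    have e2 : overlapSum true n (k + 2) ≤ 432 * c * ρ * (17 * c ^ 3) := by
      refine r4.trans ?_
      gcongr
      linarith [one_le_pow₀ hc (n := 3)]
    have o1 := overlapSum_nonneg false n k
    have o2 := overlapSum_nonneg true n (k + 2)
    calc jointError n k (k + 2) = 3 * F * overlapSum false n k
          + 2 * (3 * F * overlapSum true n (k + 2)) + 3 * H2 * overlapSum true n (k + 2) := rfl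
      _ ≤ 3 * c * (432 * c * ρ * (2 * c)) + 2 * (3 * c * (432 * c * ρ * (17 * c ^ 3)))
          + 3 * (16 * c ^ 3) * (432 * c * ρ * (17 * c ^ 3)) := by gcongr
      _ = (2592 * c ^ 3 + 44064 * c ^ 5 + 352512 * c ^ 7) * ρ := by ring
      _ ≤ 400000 * c ^ 7 * ρ := by
        gcongr
        linarith [hcp 3 7 (by norm_num), hcp 5 7 (by norm_num), one_le_pow₀ hc (n := 7)]
  · refine (real_compl_typicalCoins_le n k).trans ?_
    have hFm : 0 < Fm := lt_of_lt_of_le (by positivity) bFm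
    have hH1 : 0 < H1 := by linarith
    have p1 := real_noCut_le false (by omega) hFm r1
    have p2 := real_noCut_le true (by omega) hH1 r3
    have q1 : 16 * (1 + 3 * (432 * c * ρ)) / Fm ≤ 640 * c * ρ := by
      calc 16 * (1 + 3 * (432 * c * ρ)) / Fm ≤ 160 / (v ^ 2 / (4 * c)) := by
            gcongr
            linarith
        _ = 640 * c * (1 / v ^ 2) := by field_simp; norm_num
        _ ≤ _ := by gcongr
    have q2 : 16 * (1 + 3 * (432 * c * ρ)) / H1 ≤ 20480 * ρ := by
      calc 16 * (1 + 3 * (432 * c * ρ)) / H1 ≤ 160 / (v ^ 2 / 128) := by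
            gcongr
            · linarith
            · linarith
        _ = 20480 * (1 / v ^ 2) := by field_simp; norm_num
        _ ≤ _ := by gcongr
    have q3 : Fp ≤ 4 * c ^ 2 * ρ := bFp.trans (by gcongr)
    have q4 : H3 ≤ 64 * c ^ 4 * ρ := bH3.trans (by gcongr)
    calc _ ≤ (640 * c * ρ + 48 * (432 * c * ρ)) + 4 * c ^ 2 * ρ
          + ((20480 * ρ + 48 * (432 * c * ρ)) + 64 * c ^ 4 * ρ) := by
          gcongr
          · exact p1.trans (by gcongr)
          · exact p2.trans (by gcongr)
      _ = (42112 * c ^ 1 + 4 * c ^ 2 + 20480 * c ^ 0 + 64 * c ^ 4) * ρ := by ring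
      _ ≤ 400000 * c ^ 7 * ρ := by
        gcongr
        linarith [hcp 1 7 (by norm_num), hcp 2 7 (by norm_num), hcp 0 7 (by norm_num),
          hcp 4 7 (by norm_num), one_le_pow₀ hc (n := 7)]

end Estimates

/-! ### The sequence along which `f (k0 n)` is bounded -/

section Sequence

open Topology

theorem f_eq_expectedCuts (n k : ℕ) : f n k = expectedCuts false n k := by
  simp [f, expectedCuts, cutWeight]

theorem bddAbove_one_le_f (n : ℕ) : BddAbove {k | 1 ≤ f n k} := by
  refine ⟨n, fun k hk => le_of_one_le_expectedCuts false (zero_lt_one.trans_le ?_)⟩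
  rw [← f_eq_expectedCuts]
  exact hk

theorem one_le_f_k0 (n : ℕ) : 1 ≤ f n (k0 n) :=
  Nat.sSup_mem ⟨0, by simp [f]⟩ (bddAbove_one_le_f n)

theorem one_le_k0 {n : ℕ} (hn : 1 ≤ n) : 1 ≤ k0 n := by
  refine le_csSup (bddAbove_one_le_f n) ?_
  have : (1 : ℝ) ≤ n := by exact_mod_cast hn
  simpa [f] using this

theorem tendsto_k0_atTop {c : ℝ} {s : ℕ → ℕ} (hs : Tendsto s atTop atTop)
    (hf : ∀ j, f (s j) (k0 (s j)) ≤ c) : Tendsto (fun j => k0 (s j)) atTop atTop := by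
  rw [tendsto_atTop]
  intro M
  have hs' : Tendsto (fun j => (s j : ℝ)) atTop atTop := tendsto_natCast_atTop_atTop.comp hs
  filter_upwards [hs'.eventually_gt_atTop (2 * c * M * √(2 ^ M)), hs.eventually_ge_atTop 1]
    with j hj hj1
  by_contra! hlt
  have h1 := one_le_f_k0 (s j)
  have h2 := hf j
  have hc : 0 ≤ c := by linarith
  rw [f_eq_expectedCuts] at h1 h2
  have h3 := (size_bounds (w := √(2 ^ k0 (s j))) (by positivity) (sq_sqrt (by positivity))
    (one_le_k0 hj1) h1 h2).1
  have h4 : 2 * c * k0 (s j) * √(2 ^ k0 (s j)) ≤ 2 * c * M * √(2 ^ M) := by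
    gcongr
    norm_num
  linarith

theorem tendsto_pow_div_two_rpow :
    Tendsto (fun k : ℕ => (k : ℝ) ^ 3 / 2 ^ ((k : ℝ) / 4)) atTop (𝓝 0) := by
  have h := tendsto_pow_const_mul_const_pow_of_abs_lt_one 3 (r := (2 : ℝ) ^ (-(1 / 4) : ℝ)) (by
    rw [abs_of_pos (by positivity)]
    exact rpow_lt_one_of_one_lt_of_neg (by norm_num) (by norm_num))
  refine h.congr fun k => ?_
  rw [div_eq_mul_inv ((k : ℝ) ^ 3), ← rpow_natCast (2 ^ _), ← rpow_mul (by norm_num),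
    ← rpow_neg (by norm_num)]
  congr 2
  ring

/-- For suitable constants, the estimates at `k0` hold with errors tending to zero. -/
theorem eventually_typical_estimates {c : ℝ} {s : ℕ → ℕ} (hs : Tendsto s atTop atTop)
    (hf : ∀ j, f (s j) (k0 (s j)) ≤ c) {η : ℝ} (hη : 0 < η) :
    ∀ᶠ j in atTop, 2 ≤ k0 (s j) ∧ jointError (s j) (k0 (s j)) (k0 (s j) + 2) ≤ η ∧
      (erdosRenyi (s j) (1 / 2)).real (typicalCoins (s j) (k0 (s j)))ᶜ ≤ η ∧
      1 / 16384 ≤ expectedCuts true (s j) (k0 (s j) + 2) ∧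
      expectedCuts true (s j) (k0 (s j) + 2) ≤ 16 * (2 * c) ^ 3 := by
  have hlim := tendsto_pow_div_two_rpow.comp (tendsto_k0_atTop hs hf)
  have hc1 : 1 ≤ c := (one_le_f_k0 (s 0)).trans (hf 0)
  have h1 : ∀ᶠ j in atTop, ((k0 (s j) : ℝ) ^ 3 / 2 ^ ((k0 (s j) : ℝ) / 4))
      < η / (400000 * (2 * c) ^ 7) := hlim.eventually_lt_const (by positivity)
  have h2 : ∀ᶠ j in atTop, ((k0 (s j) : ℝ) ^ 3 / 2 ^ ((k0 (s j) : ℝ) / 4))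
      < 1 / (144 * (2 * c)) := hlim.eventually_lt_const (by positivity)
  filter_upwards [h1, h2, hs.eventually_ge_atTop 1] with j h1 h2 hj
  set k := k0 (s j)
  set v : ℝ := 2 ^ ((k : ℝ) / 4) with hv
  have hv0 : 0 < v := by positivity
  have hvk : v ^ 4 = 2 ^ k := by
    rw [hv, ← rpow_natCast, ← rpow_mul (by norm_num), ← rpow_natCast 2 k]
    congr 1
    push_cast
    ring
  have hk := one_le_k0 hj
  have hF1 := one_le_f_k0 (s j)
  have hF2 := hf j
  rw [f_eq_expectedCuts] at hF1 hF2
  have hsize := size_bounds (w := v ^ 2) (by positivity) (by rw [← pow_mul, ← hvk]) hk hF1 hF2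
  rw [div_lt_div_iff₀ hv0 (by positivity)] at h2
  rw [lt_div_iff₀' (by positivity)] at h1
  obtain ⟨e1, e2, e3, e4, e5⟩ := typical_estimates hk hv0 hvk (by linarith : 1 ≤ 2 * c) hF1
    (by linarith) hsize.1 hsize.2 (by linarith)
  exact ⟨e1, e2.trans h1.le, e3.trans h1.le, e4, e5⟩

theorem cutWeight_le_half {k : ℕ} (hk : 2 ≤ k) :
    cutWeight false k ≤ 1 / 2 ∧ cutWeight true (k + 2) ≤ 1 / 2 := by
  have h1 : 1 ≤ k.choose 2 := Nat.choose_pos hk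
  have h2 : k + 2 + 1 ≤ (k + 2).choose 2 := by
    have := two_mul_choose_two_add (k + 2)
    nlinarith
  have h3 : ∀ i j : ℕ, i + 1 ≤ j → (2 : ℝ) ^ i / 2 ^ j ≤ 1 / 2 := by
    intro i j hij
    rw [div_le_div_iff₀ (by positivity) two_pos, ← pow_succ, one_mul]
    exact pow_le_pow_right₀ (by norm_num) hij
  exact ⟨h3 _ _ (by simpa using h1), h3 _ _ (by simpa using h2)⟩

/-- The coin flips for which `alpha` is `k - e1` and `beta` is `k + 2 - e2`. -/
def alphaBetaEvent (n k e1 e2 : ℕ) : Set (Sym2 (Fin n) → Bool) :=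
  {ω | alpha (graphOf n ω) = k - e1 ∧ beta (graphOf n ω) = k + 2 - e2}

theorem le_real_alphaBetaEvent {n k : ℕ} {δ : ℝ} (hδ : 0 ≤ δ) (hk1 : 1 ≤ k)
    (hk : δ ≤ noCutApprox false n k) (hk' : noCutApprox false n k ≤ 1 - δ)
    (hm : δ ≤ noCutApprox true n (k + 2)) (hm' : noCutApprox true n (k + 2) ≤ 1 - δ)
    {e1 e2 : ℕ} (he1 : e1 ≤ 1) (he2 : e2 ≤ 1) :
    δ ^ 2 - 3 * jointError n k (k + 2) - (erdosRenyi n (1 / 2)).real (typicalCoins n k)ᶜ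
      ≤ (erdosRenyi n (1 / 2)).real (alphaBetaEvent n k e1 e2) := by
  obtain ⟨h1, h2, h3, h4⟩ := le_real_noCut_patterns (n := n) (show k < k + 2 by omega) hδ
    hk hk' hm hm'
  have key : ∀ S : Set (Sym2 (Fin n) → Bool), S ∩ typicalCoins n k ⊆ alphaBetaEvent n k e1 e2 →
      δ ^ 2 - 3 * jointError n k (k + 2) ≤ (erdosRenyi n (1 / 2)).real S →
      δ ^ 2 - 3 * jointError n k (k + 2) - (erdosRenyi n (1 / 2)).real (typicalCoins n k)ᶜ
        ≤ (erdosRenyi n (1 / 2)).real (alphaBetaEvent n k e1 e2) := by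
    intro S hS hle
    have hsub : S ⊆ alphaBetaEvent n k e1 e2 ∪ (typicalCoins n k)ᶜ := fun ω hω =>
      (em (ω ∈ typicalCoins n k)).imp (fun h => hS ⟨hω, h⟩) id
    have := (measureReal_mono (μ := erdosRenyi n (1 / 2)) hsub).trans (measureReal_union_le _ _)
    linarith
  interval_cases e1 <;> interval_cases e2
  · refine key _ ?_ h4
    rintro ω ⟨hω, ht⟩
    rw [Set.mem_compl_iff, Set.mem_union, not_or] at hω
    exact ⟨(alpha_of_mem_typicalCoins hk1 ht).2 hω.1, (beta_of_mem_typicalCoins ht).2 hω.2⟩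
  · refine key _ ?_ h3
    rintro ω ⟨hω, ht⟩
    exact ⟨(alpha_of_mem_typicalCoins hk1 ht).2 hω.2, (beta_of_mem_typicalCoins ht).1 hω.1⟩
  · refine key _ ?_ h2
    rintro ω ⟨hω, ht⟩
    exact ⟨(alpha_of_mem_typicalCoins hk1 ht).1 hω.1, (beta_of_mem_typicalCoins ht).2 hω.2⟩
  · refine key _ ?_ h1
    rintro ω ⟨hω, ht⟩
    exact ⟨(alpha_of_mem_typicalCoins hk1 ht).1 hω.1, (beta_of_mem_typicalCoins ht).1 hω.2⟩

theorem exists_pos_eventually_le_real_alphaBetaEvent {c : ℝ} {s : ℕ → ℕ}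
    (hs : Tendsto s atTop atTop) (hf : ∀ j, f (s j) (k0 (s j)) ≤ c) :
    ∃ ε > 0, ∀ᶠ j in atTop, 1 ≤ k0 (s j) ∧ ∀ e1 e2 : ℕ, e1 ≤ 1 → e2 ≤ 1 →
      ε ≤ (erdosRenyi (s j) (1 / 2)).real (alphaBetaEvent (s j) (k0 (s j)) e1 e2) := by
  have hc1 : 1 ≤ c := (one_le_f_k0 (s 0)).trans (hf 0)
  obtain ⟨δ, hδ0, hδ⟩ : ∃ δ > 0,
      δ ≤ exp (-(2 * (16 * (2 * c) ^ 3))) ∧ δ ≤ 1 - exp (-(1 / 65536)) := by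
    refine ⟨min (exp (-(2 * (16 * (2 * c) ^ 3)))) (1 - exp (-(1 / 65536))), lt_min (exp_pos _) ?_,
      min_le_left _ _, min_le_right _ _⟩
    rw [sub_pos, exp_lt_one_iff]
    norm_num
  have hc3 : c ≤ 16 * (2 * c) ^ 3 := by
    have := le_self_pow₀ hc1 (by norm_num : 3 ≠ 0)
    nlinarith
  refine ⟨δ ^ 2 / 2, by positivity, ?_⟩
  filter_upwards [eventually_typical_estimates hs hf (show 0 < δ ^ 2 / 8 by positivity)]
    with j ⟨hk, hJ, htyp, hH1, hH2⟩
  refine ⟨by omega, fun e1 e2 he1 he2 => ?_⟩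
  have hF1 := one_le_f_k0 (s j)
  have hF2 := hf j
  rw [f_eq_expectedCuts] at hF1 hF2
  have hbd : ∀ b m, 2 ≤ m → cutWeight b m ≤ 1 / 2 → 1 / 16384 ≤ expectedCuts b (s j) m →
      expectedCuts b (s j) m ≤ 16 * (2 * c) ^ 3 →
      δ ≤ noCutApprox b (s j) m ∧ noCutApprox b (s j) m ≤ 1 - δ := by
    intro b m hm hw hlo hhi
    constructor
    · refine (hδ.1.trans ?_).trans (le_noCutApprox b (s j) hw)
      gcongr
    · have h1 : exp (-(expectedCuts b (s j) m / 4)) ≤ exp (-(1 / 65536)) := by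
        rw [exp_le_exp]
        linarith
      linarith [noCutApprox_le b (s j) hm, hδ.2]
  obtain ⟨w1, w2⟩ := cutWeight_le_half hk
  obtain ⟨a1, a2⟩ := hbd false _ hk w1 (by linarith) (by linarith)
  obtain ⟨b1, b2⟩ := hbd true _ (by omega) w2 hH1 hH2
  have := le_real_alphaBetaEvent hδ0.le (by omega) a1 a2 b1 b2 he1 he2
  linarith

theorem tendsto_typicalCoins {c : ℝ} {s : ℕ → ℕ}
    (hs : Tendsto s atTop atTop) (hf : ∀ j, f (s j) (k0 (s j)) ≤ c) :
    Tendsto (fun j => erdosRenyi (s j) (1 / 2) (typicalCoins (s j) (k0 (s j)))) atTop (𝓝 1) := by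
  have hreal : Tendsto (fun j => (erdosRenyi (s j) (1 / 2)).real (typicalCoins (s j) (k0 (s j))))
      atTop (𝓝 1) := by
    rw [Metric.tendsto_nhds]
    intro ε hε
    filter_upwards [eventually_typical_estimates hs hf (half_pos hε)] with j hj
    have h1 := hj.2.2.1
    rw [probReal_compl_eq_one_sub (measurableSet_coins _)] at h1
    rw [Real.dist_eq, abs_lt]
    have h2 : (erdosRenyi (s j) (1 / 2)).real (typicalCoins (s j) (k0 (s j))) ≤ 1 :=
      measureReal_le_one
    constructor <;> linarith
  have h := ENNReal.tendsto_ofReal hreal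
  rw [ENNReal.ofReal_one] at h
  exact h.congr fun j => ofReal_measureReal

end Sequence

/-- along a sequence with `c1 ≤ f(k₀) ≤ c2`, whp one of four possibilities for
`(α(G), β(G))` holds, and each possibility has probability bounded away from 0 and 1. -/
theorem four_cases_at_k0
    (c1 c2 : ℝ) (hc1 : 0 < c1) (hc12 : c1 ≤ c2)
    (s : ℕ → ℕ) (hs : StrictMono s)
    (hf : ∀ j, c1 ≤ f (s j) (k0 (s j)) ∧ f (s j) (k0 (s j)) ≤ c2) :
    (Tendsto (fun j => erdosRenyi (s j) (1/2)
      {ω | (alpha (graphOf (s j) ω) = k0 (s j) ∧ beta (graphOf (s j) ω) = k0 (s j) + 2) ∨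
           (alpha (graphOf (s j) ω) = k0 (s j) ∧ beta (graphOf (s j) ω) = k0 (s j) + 1) ∨
           (alpha (graphOf (s j) ω) = k0 (s j) - 1 ∧ beta (graphOf (s j) ω) = k0 (s j) + 2) ∨
           (alpha (graphOf (s j) ω) = k0 (s j) - 1 ∧ beta (graphOf (s j) ω) = k0 (s j) + 1)})
      atTop (nhds 1)) ∧
    (∀ e1 e2 : ℕ, e1 ≤ 1 → e2 ≤ 1 →
      0 < Filter.liminf (fun j => erdosRenyi (s j) (1/2)
        {ω | alpha (graphOf (s j) ω) = k0 (s j) - e1 ∧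
             beta (graphOf (s j) ω) = k0 (s j) + 2 - e2}) atTop ∧
      Filter.limsup (fun j => erdosRenyi (s j) (1/2)
        {ω | alpha (graphOf (s j) ω) = k0 (s j) - e1 ∧
             beta (graphOf (s j) ω) = k0 (s j) + 2 - e2}) atTop < 1) := by
  have hs' := hs.tendsto_atTop
  have hf' := fun j => (hf j).2
  obtain ⟨ε, hε, hev⟩ := exists_pos_eventually_le_real_alphaBetaEvent hs' hf'
  refine ⟨?_, fun e1 e2 he1 he2 => ⟨?_, ?_⟩⟩
  · refine tendsto_of_tendsto_of_tendsto_of_le_of_le' (tendsto_typicalCoins hs' hf')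
      tendsto_const_nhds ?_ (Eventually.of_forall fun j => prob_le_one)
    filter_upwards [hev] with j hj
    refine measure_mono fun ω hω => ?_
    have hα := alpha_of_mem_typicalCoins hj.1 hω
    have hβ := beta_of_mem_typicalCoins hω
    rw [Set.mem_ofPred_eq]
    tauto
  · refine (ENNReal.ofReal_pos.2 hε).trans_le (le_liminf_of_le (by isBoundedDefault) ?_)
    filter_upwards [hev] with j hj
    exact ENNReal.ofReal_le_of_le_toReal (hj.2 e1 e2 he1 he2)
  · refine (limsup_le_of_le (a := ENNReal.ofReal (1 - ε)) (by isBoundedDefault) ?_).trans_lt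
      (ENNReal.ofReal_lt_one.2 (by linarith))
    filter_upwards [hev] with j hj
    have hdisj : alphaBetaEvent (s j) (k0 (s j)) e1 e2
        ⊆ (alphaBetaEvent (s j) (k0 (s j)) (1 - e1) e2)ᶜ := by
      rintro ω ⟨h1, -⟩ ⟨h2, -⟩
      have := hj.1
      omega
    have h1 := measureReal_mono (μ := erdosRenyi (s j) (1 / 2)) hdisj
    rw [probReal_compl_eq_one_sub (measurableSet_coins _)] at h1
    have h2 := hj.2 (1 - e1) e2 (by omega) he2
    change erdosRenyi (s j) (1 / 2) (alphaBetaEvent (s j) (k0 (s j)) e1 e2) ≤ _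
    rw [← ofReal_measureReal]
    exact ENNReal.ofReal_le_ofReal (by linarith)

end RandomBipartiteDecomposition
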